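/- Let A be a separable, nowhere scattered C*-algebra of topological dimension zero. Then the set Cu(A)_wdiv of elements x ∈ Cu(A) with wdiv_{2m}(x) < ∞ for some m ≥ 1 is sup-dense in Cu(A). -/

import Mathlib

/-!
Common definitions: abstract Cuntz semigroups, divisibility, and C*-algebra notions
(nowhere scatteredness, σ-unitality, etc.) used to formalize the statements.
-/

open scoped MultiplierAlgebra ENNReal
open Filter Topology

noncomputable section

universe uu vv

/-- The (sequential) way-below relation `x ≪ y` (compact containment) in a partially
ordered set: whenever an increasing sequence has a supremum lying above `y`, some term
of the sequence already lies above `x`. -/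
def WayBelow {S : Type*} [PartialOrder S] (x y : S) : Prop :=
  ∀ f : ℕ → S, Monotone f → ∀ s : S, IsLUB (Set.range f) s → y ≤ s → ∃ n, x ≤ f n

/-- An abstract Cuntz semigroup (`Cu`-semigroup): a positively ordered abelian monoid in
which every increasing sequence has a supremum, every element is the supremum of a
`≪`-increasing sequence, addition preserves `≪`, and which satisfies the standard
axioms (O5) (almost algebraic order) and (O6) (almost Riesz decomposition), as well as
the existence of infima with idempotents `∞y = sup_n n•y` (all of these hold in the
Cuntz semigroup of any C*-algebra). -/
class CuSemigroup (S : Type*) extends AddCommMonoid S, PartialOrder S where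
  add_le_add' : ∀ a b : S, a ≤ b → ∀ c : S, c + a ≤ c + b
  zero_le' : ∀ x : S, 0 ≤ x
  exists_isLUB : ∀ f : ℕ → S, Monotone f → ∃ s : S, IsLUB (Set.range f) s
  exists_waybelow_seq : ∀ x : S, ∃ f : ℕ → S, Monotone f ∧
    (∀ n, WayBelow (f n) (f (n + 1))) ∧ IsLUB (Set.range f) x
  waybelow_add : ∀ {x y z w : S}, WayBelow x y → WayBelow z w → WayBelow (x + z) (y + w)
  /-- axiom (O5) -/
  almost_algebraic : ∀ x' x y' y z : S, WayBelow x' x → WayBelow y' y → x + y ≤ z →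
    ∃ c : S, y' ≤ c ∧ x' + c ≤ z ∧ z ≤ x + c
  /-- axiom (O6) -/
  almost_riesz : ∀ x' x y z : S, WayBelow x' x → x ≤ y + z →
    ∃ v w : S, v ≤ x ∧ v ≤ y ∧ w ≤ x ∧ w ≤ z ∧ x' ≤ v + w
  /-- `infty y = ∞·y = sup_n n•y` -/
  infty : S → S
  isLUB_infty : ∀ y : S, IsLUB (Set.range fun n : ℕ => n • y) (infty y)
  /-- the infimum `x ⊓ ∞y`, which exists in the Cuntz semigroup of any C*-algebra -/
  meetInfty : S → S → S
  isGLB_meetInfty : ∀ x y : S, IsGLB {x, infty y} (meetInfty x y)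

namespace CuDiv

variable {S : Type*} [CuSemigroup S]

/-- `x` is weakly `(m, n)`-divisible. -/
def IsWeaklyDivisible (m n : ℕ) (x : S) : Prop :=
  ∀ x' : S, WayBelow x' x → ∃ y : Fin n → S, x' ≤ ∑ j, y j ∧ ∀ j, m • y j ≤ x

/-- `x` is `(m, n)`-divisible. -/
def IsDivisible (m n : ℕ) (x : S) : Prop :=
  ∀ x' : S, WayBelow x' x → ∃ y : S, x' ≤ n • y ∧ m • y ≤ x

/-- `x` is weakly `(m, ω)`-divisible. -/
def IsWeaklyOmegaDivisible (m : ℕ) (x : S) : Prop :=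
  ∀ x' : S, WayBelow x' x → ∃ (n : ℕ) (y : Fin n → S), x' ≤ ∑ j, y j ∧ ∀ j, m • y j ≤ x

/-- `x` is `(m, ω)`-divisible. -/
def IsOmegaDivisible (m : ℕ) (x : S) : Prop :=
  ∀ x' : S, WayBelow x' x → ∃ (y : S) (n : ℕ), x' ≤ n • y ∧ m • y ≤ x

/-- `wdiv m x` is the least positive integer `n` such that `x` is weakly
`(m,n)`-divisible, and `∞` if there is no such `n`. -/
def wdiv (m : ℕ) (x : S) : ℕ∞ :=
  sInf {N : ℕ∞ | ∃ n : ℕ, 1 ≤ n ∧ N = n ∧ IsWeaklyDivisible m n x}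

/-- `Div m x` is the least positive integer `n` such that `x` is `(m,n)`-divisible,
and `∞` if there is no such `n`. -/
def Div (m : ℕ) (x : S) : ℕ∞ :=
  sInf {N : ℕ∞ | ∃ n : ℕ, 1 ≤ n ∧ N = n ∧ IsDivisible m n x}

/-- An element `x` is strongly soft if for every `x' ≪ x` there is `t` with
`x' + t ≤ x ≤ ∞t`. -/
def StronglySoft (x : S) : Prop :=
  ∀ x' : S, WayBelow x' x → ∃ t : S, x' + t ≤ x ∧ x ≤ CuSemigroup.infty t

/-- The Cuntz semigroup characterization of the Global Glimm Property: every element is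
`(m, ω)`-divisible for every `m`. -/
def GlobalGlimm (S : Type*) [CuSemigroup S] : Prop :=
  ∀ (m : ℕ) (x : S), IsOmegaDivisible m x

/-- `Cu(A)` is left-soft separative. -/
def LeftSoftSeparative (S : Type*) [CuSemigroup S] : Prop :=
  ∀ x y t : S, StronglySoft x → WayBelow (x + t) (y + t) →
    WayBelow t (CuSemigroup.infty y) → WayBelow t (CuSemigroup.infty x) → WayBelow x y

/-- `Cu(A)` is weakly cancellative. -/
def WeaklyCancellative (S : Type*) [CuSemigroup S] : Prop :=
  ∀ x y z : S, WayBelow (x + z) (y + z) → WayBelow x y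

/-- `Cu(A)` has covering dimension zero. -/
def CoveringDimZero (S : Type*) [CuSemigroup S] : Prop :=
  ∀ x' x y₁ y₂ : S, WayBelow x' x → WayBelow x (y₁ + y₂) →
    ∃ z₁ z₂ : S, z₁ ≤ y₁ ∧ z₂ ≤ y₂ ∧ x' ≤ z₁ + z₂ ∧ z₁ + z₂ ≤ x

end CuDiv

/-- A functional on a Cuntz semigroup: an additive, order preserving map to `ℝ≥0∞`
preserving suprema of increasing sequences.  (By Elliott–Robert–Santiago, the
functionals on `Cu(A)` are exactly those induced by the lower semicontinuous
2-quasitraces on `A ⊗ K`.) -/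
structure CuFunctional (S : Type*) [CuSemigroup S] where
  toFun : S → ℝ≥0∞
  map_zero' : toFun 0 = 0
  map_add' : ∀ x y : S, toFun (x + y) = toFun x + toFun y
  mono' : ∀ x y : S, x ≤ y → toFun x ≤ toFun y
  sup' : ∀ f : ℕ → S, Monotone f → ∀ s : S, IsLUB (Set.range f) s →
    toFun s = ⨆ n, toFun (f n)

instance {S : Type*} [CuSemigroup S] : CoeFun (CuFunctional S) fun _ => S → ℝ≥0∞ :=
  ⟨CuFunctional.toFun⟩

namespace CuDiv

variable {S : Type*} [CuSemigroup S]

/-- `x <ₛ y` : there is `γ < 1` with `λ(x) ≤ γ·λ(y)` for every functional `λ`. -/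
def FunctionalLT (x y : S) : Prop :=
  ∃ γ : ℝ≥0∞, γ < 1 ∧ ∀ lam : CuFunctional S, lam x ≤ γ * lam y

/-- `A` has `k`-comparison (stated on `Cu(A)`). -/
def KComparison (S : Type*) [CuSemigroup S] (k : ℕ) : Prop :=
  ∀ (x : S) (b : Fin (k + 1) → S), (∀ i, FunctionalLT x (b i)) → x ≤ ∑ i, b i

/-- `A` has strict comparison (stated on `Cu(A)`, via functionals, which correspond to
the lower semicontinuous 2-quasitraces). -/
def StrictComparison (S : Type*) [CuSemigroup S] : Prop :=
  ∀ x y : S, FunctionalLT x y → x ≤ y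

/-- The natural topology on the cone `F(Cu(A))` of functionals. -/
def functionalTopology (S : Type*) [CuSemigroup S] : TopologicalSpace (CuFunctional S) :=
  TopologicalSpace.generateFrom
    ({U | ∃ (x : S) (r : ℝ≥0∞), U = {lam : CuFunctional S | r < lam x}} ∪
      {U | ∃ (x' x : S) (r : ℝ≥0∞), WayBelow x' x ∧ U = {lam : CuFunctional S | lam x' < r}})

/-- A lower semicontinuous affine function on the cone of functionals of `Cu(A)`,
i.e. an element of `L(F(Cu(A)))`. -/
def IsLscAffine (F : CuFunctional S → ℝ≥0∞) : Prop :=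
  (letI := functionalTopology S; LowerSemicontinuous F) ∧
    (∀ lam mu nu : CuFunctional S, (∀ x, nu x = lam x + mu x) → F nu = F lam + F mu) ∧
    (∀ (r : ℝ≥0∞) (lam nu : CuFunctional S), (∀ x, nu x = r * lam x) → F nu = r * F lam)

/-- The rank map of `Cu(A)` is surjective: every lower semicontinuous affine function on
the cone of functionals is realized as the rank function `λ ↦ λ(x)` of an element. -/
def SurjectiveRankMap (S : Type*) [CuSemigroup S] : Prop :=
  ∀ F : CuFunctional S → ℝ≥0∞, IsLscAffine F → ∃ y : S, ∀ lam : CuFunctional S, lam y = F lam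

end CuDiv

/-! ### C*-algebra notions -/

section CStar

variable {B : Type*} [NonUnitalCStarAlgebra B]

/-- Positivity in a C*-algebra: `a` is positive iff it is of the form `star b * b`. -/
def CStarNonneg (a : B) : Prop := ∃ b : B, a = star b * b

/-- Cuntz subequivalence `a ≼ b` : `a = lim_n rₙ b rₙ*`. -/
def CuntzBelow (a b : B) : Prop :=
  ∃ r : ℕ → B, Tendsto (fun n => r n * b * star (r n)) atTop (𝓝 a)

/-- Cuntz equivalence. -/
def CuntzEquiv (a b : B) : Prop := CuntzBelow a b ∧ CuntzBelow b a

/-- `A` is σ-unital: it has a countable (norm-bounded, positive) approximate unit. -/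
def SigmaUnital (A : Type*) [NonUnitalCStarAlgebra A] : Prop :=
  ∃ e : ℕ → A, (∀ n, CStarNonneg (e n) ∧ ‖e n‖ ≤ 1) ∧
    ∀ a : A, Tendsto (fun n => e n * a) atTop (𝓝 a) ∧ Tendsto (fun n => a * e n) atTop (𝓝 a)

end CStar

/-- A closed two-sided (automatically star-closed) ideal of a C*-algebra. -/
structure ClosedTwoSidedIdealC (A : Type*) [NonUnitalCStarAlgebra A] where
  carrier : NonUnitalStarSubalgebra ℂ A
  isClosed : IsClosed (carrier : Set A)
  mul_mem_left : ∀ a : A, ∀ x ∈ carrier, a * x ∈ carrier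
  mul_mem_right : ∀ a : A, ∀ x ∈ carrier, x * a ∈ carrier

section Reps

variable {A : Type*} [NonUnitalCStarAlgebra A]
variable {H : Type*} [NormedAddCommGroup H] [InnerProductSpace ℂ H] [CompleteSpace H]

/-- A (topologically) irreducible representation of `A` on a Hilbert space `H`. -/
def IsIrreducibleRep (π : A →⋆ₙₐ[ℂ] (H →L[ℂ] H)) : Prop :=
  (∃ a : A, π a ≠ 0) ∧
    ∀ K : Submodule ℂ H, IsClosed (K : Set H) → (∀ a : A, ∀ v ∈ K, π a v ∈ K) →
      K = ⊥ ∨ K = ⊤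

end Reps

/-- `A` has a nonzero elementary ideal-quotient `J/I`, expressed via a surjection of a
closed two-sided ideal `J` of `A` onto the algebra of compact operators on a Hilbert
space (the kernel `I` of such a `*`-homomorphism is automatically a closed two-sided
ideal of `A`, and conversely any nonzero elementary ideal-quotient arises this way). -/
def HasNonzeroElementaryIdealQuotient (A : Type*) [NonUnitalCStarAlgebra A] : Prop :=
  ∃ (J : ClosedTwoSidedIdealC A) (H : Type) (_ : NormedAddCommGroup H)
    (_ : InnerProductSpace ℂ H) (_ : CompleteSpace H)
    (ψ : J.carrier →⋆ₙₐ[ℂ] (H →L[ℂ] H)),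
      Set.range ψ = {T : H →L[ℂ] H | IsCompactOperator ⇑T} ∧ ∃ x, ψ x ≠ 0

/-- A C*-algebra is nowhere scattered if no ideal-quotient of it is nonzero and
elementary. -/
def NowhereScattered (A : Type*) [NonUnitalCStarAlgebra A] : Prop :=
  ¬ HasNonzeroElementaryIdealQuotient A

/-- A C*-algebra is elementary if it is isomorphic to the algebra of compact operators
on some Hilbert space. -/
def IsElementaryCStar (A : Type*) [NonUnitalCStarAlgebra A] : Prop :=
  ∃ (H : Type) (_ : NormedAddCommGroup H) (_ : InnerProductSpace ℂ H) (_ : CompleteSpace H)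
    (ψ : A →⋆ₙₐ[ℂ] (H →L[ℂ] H)),
      Function.Injective ψ ∧ Set.range ψ = {T : H →L[ℂ] H | IsCompactOperator ⇑T}

/-- A C*-algebra is simple if it is nonzero and has no nontrivial closed two-sided
ideals. -/
def IsSimpleCStar (A : Type*) [NonUnitalCStarAlgebra A] : Prop :=
  (∃ a : A, a ≠ 0) ∧
    ∀ J : ClosedTwoSidedIdealC A, (J.carrier : Set A) = {0} ∨ (J.carrier : Set A) = Set.univ

/-- Real rank zero: the invertible self-adjoint elements are dense in the self-adjoint
part of the minimal unitization. -/
def RealRankZero (A : Type*) [NonUnitalCStarAlgebra A] : Prop :=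
  ∀ x : Unitization ℂ A, IsSelfAdjoint x →
    x ∈ closure {y : Unitization ℂ A | IsSelfAdjoint y ∧ IsUnit y}

/-- Stable rank one: the invertible elements are dense in the minimal unitization. -/
def StableRankOne (A : Type*) [NonUnitalCStarAlgebra A] : Prop :=
  ∀ x : Unitization ℂ A, x ∈ closure {y : Unitization ℂ A | IsUnit y}

section CP

variable {A B : Type*} [NonUnitalCStarAlgebra A] [NonUnitalCStarAlgebra B]

/-- A linear map between C*-algebras is completely positive if all of its matrix
amplifications preserve positivity. -/
def IsCompletelyPositive (φ : A →ₗ[ℂ] B) : Prop :=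
  ∀ (n : ℕ) (a : Matrix (Fin n) (Fin n) A), (∃ b : Matrix (Fin n) (Fin n) A, a = star b * b) →
    ∃ c : Matrix (Fin n) (Fin n) B, a.map ⇑φ = star c * c

/-- A completely positive contractive (c.p.c.) map. -/
def IsCPC (φ : A →ₗ[ℂ] B) : Prop :=
  IsCompletelyPositive φ ∧ ∀ a : A, ‖φ a‖ ≤ ‖a‖

/-- A map between C*-algebras has order zero if it preserves orthogonality of positive
elements. -/
def IsOrderZero (φ : A →ₗ[ℂ] B) : Prop :=
  ∀ a b : A, CStarNonneg a → CStarNonneg b → a * b = 0 → φ a * φ b = 0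

end CP

/-- `A` has nuclear dimension at most `k`: there are c.p.c. approximations of the
identity through finite dimensional C*-algebras in which the downwards maps are sums of
`k+1` c.p.c. order zero maps. -/
def NuclearDimLE (A : Type*) [NonUnitalCStarAlgebra A] (k : ℕ) : Prop :=
  ∀ (F : Finset A) (ε : ℝ), 0 < ε →
    ∃ (Fd : Type) (_ : NonUnitalCStarAlgebra Fd) (_ : FiniteDimensional ℂ Fd)
      (ψ : A →ₗ[ℂ] Fd) (φ : Fin (k + 1) → (Fd →ₗ[ℂ] A)),
        IsCPC ψ ∧ (∀ i, IsCPC (φ i) ∧ IsOrderZero (φ i)) ∧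
        ∀ a ∈ F, ‖(∑ i, φ i (ψ a)) - a‖ ≤ ε

section Prim

variable (A : Type*) [NonUnitalCStarAlgebra A]

/-- A primitive ideal: the kernel of an irreducible representation. -/
def IsPrimitiveIdeal {A : Type*} [NonUnitalCStarAlgebra A] (J : ClosedTwoSidedIdealC A) : Prop :=
  ∃ (H : Type) (_ : NormedAddCommGroup H) (_ : InnerProductSpace ℂ H) (_ : CompleteSpace H)
    (π : A →⋆ₙₐ[ℂ] (H →L[ℂ] H)),
      IsIrreducibleRep π ∧ ∀ a : A, a ∈ J.carrier ↔ π a = 0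

/-- The primitive ideal space of `A`. -/
def PrimIdealSpace := {J : ClosedTwoSidedIdealC A // IsPrimitiveIdeal J}

/-- The hull-kernel (Jacobson) topology on the primitive ideal space. -/
instance : TopologicalSpace (PrimIdealSpace A) :=
  TopologicalSpace.generateFrom {U | ∃ a : A, U = {P : PrimIdealSpace A | a ∉ P.1.carrier}}

/-- `A` has topological dimension zero: the primitive ideal space has a basis of
compact open sets. -/
def TopDimZero : Prop :=
  ∃ 𝒷 : Set (Set (PrimIdealSpace A)), TopologicalSpace.IsTopologicalBasis 𝒷 ∧
    ∀ U ∈ 𝒷, IsCompact U ∧ IsOpen U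

end Prim

section Proj

variable {B : Type*} [NonUnitalCStarAlgebra B]

/-- A projection in a C*-algebra. -/
def IsProjectionElem (p : B) : Prop := IsSelfAdjoint p ∧ p * p = p

/-- `B` contains an infinite projection: a projection which is Murray-von Neumann
equivalent to a proper subprojection of itself. -/
def HasInfiniteProjection (B : Type*) [NonUnitalCStarAlgebra B] : Prop :=
  ∃ p v : B, IsProjectionElem p ∧ star v * v = p ∧
    p * (v * star v) = v * star v ∧ v * star v ≠ p

end Proj

/-! ### The Cuntz semigroup of a C*-algebra -/

/-- Padding a matrix by one extra row and column of zeros. -/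
def matPad {A : Type*} [Zero A] {n : ℕ} (a : Matrix (Fin n) (Fin n) A) :
    Matrix (Fin (n + 1)) (Fin (n + 1)) A :=
  Matrix.of fun i j =>
    if h : (i : ℕ) < n ∧ (j : ℕ) < n then a ⟨i, h.1⟩ ⟨j, h.2⟩ else 0

/-- A witness that `S` is the Cuntz semigroup of the C*-algebra `A`: it provides a
stabilization `stab` of `A` (a model of `A ⊗ K`, described as the C*-completion of the
union of the matrix algebras `Mₙ(A)`), together with the class map
`cls : (stab)₊ → S = Cu(A)` identifying `S` with the set of Cuntz equivalence classes of
positive elements of `A ⊗ K`, with order induced by Cuntz subequivalence, addition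
induced by orthogonal (diagonal) addition, and with the compact containment relation
`≪` given by `x ≪ [a]` iff `x ≤ [(a - ε)₊]` for some `ε > 0`. -/
structure IsCuntzSemigroupOf (A : Type uu) [NonUnitalCStarAlgebra A]
    (S : Type vv) [CuSemigroup S] where
  stab : Type (max uu vv)
  [stabCStar : NonUnitalCStarAlgebra stab]
  matEmb : (n : ℕ) → (Matrix (Fin n) (Fin n) A →⋆ₙₐ[ℂ] stab)
  matEmb_injective : ∀ n, Function.Injective (matEmb n)
  matEmb_compat : ∀ (n : ℕ) (a : Matrix (Fin n) (Fin n) A), matEmb (n + 1) (matPad a) = matEmb n a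
  matEmb_dense : Dense (⋃ n, Set.range (matEmb n))
  cls : stab → S
  cls_zero : cls 0 = 0
  cls_surj : ∀ s : S, ∃ b : stab, CStarNonneg b ∧ cls b = s
  cls_le_iff : ∀ a b : stab, CStarNonneg a → CStarNonneg b → (cls a ≤ cls b ↔ CuntzBelow a b)
  cls_add_orth : ∀ a b : stab, CStarNonneg a → CStarNonneg b → a * b = 0 →
    cls (a + b) = cls a + cls b
  exists_orth : ∀ a b : stab, CStarNonneg a → CStarNonneg b →
    ∃ a' b' : stab, CStarNonneg a' ∧ CStarNonneg b' ∧ a' * b' = 0 ∧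
      cls a' = cls a ∧ cls b' = cls b
  waybelow_iff : ∀ (x : S) (a : stab), CStarNonneg a →
    (WayBelow x (cls a) ↔ ∃ ε : ℝ, 0 < ε ∧ x ≤ cls (cfcₙ (fun t : ℝ => max (t - ε) 0) a))

attribute [instance] IsCuntzSemigroupOf.stabCStar

/-- The Cuntz class `[a] ∈ Cu(A)` of an element `a` of `A` itself (via the canonical
embedding `A ≅ M₁(A) ⊆ A ⊗ K`). -/
def IsCuntzSemigroupOf.clsA {A : Type*} [NonUnitalCStarAlgebra A] {S : Type*} [CuSemigroup S]
    (h : IsCuntzSemigroupOf A S) (a : A) : S :=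
  h.cls (h.matEmb 1 (Matrix.of fun _ _ => a))

/-- `B` has a surjective rank map (every lower semicontinuous affine function on the
cone of functionals on `Cu(B)` is realized as a rank function). -/
def HasSurjectiveRankMap (B : Type*) [NonUnitalCStarAlgebra B] : Prop :=
  ∀ (S : Type) (inst : CuSemigroup S), IsCuntzSemigroupOf B S → CuDiv.SurjectiveRankMap S

/-- The family of separable sub-C*-algebras of `A` having a surjective rank map. -/
def sepSurjRankFamily (A : Type*) [NonUnitalCStarAlgebra A] :
    Set (NonUnitalStarSubalgebra ℂ A) :=
  {B | ∃ _h : IsClosed (B : Set A),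
    TopologicalSpace.SeparableSpace B ∧ HasSurjectiveRankMap B}

/-- The family of separable sub-C*-algebras of `A` with a surjective rank map is
σ-complete (closed under countable increasing unions) and cofinal (every separable
sub-C*-algebra is contained in a member). -/
def SepSurjRankFamilySigmaCompleteCofinal (A : Type*) [NonUnitalCStarAlgebra A] : Prop :=
  (∀ Bseq : ℕ → NonUnitalStarSubalgebra ℂ A, Monotone Bseq →
    (∀ n, Bseq n ∈ sepSurjRankFamily A) →
      (⨆ n, Bseq n).topologicalClosure ∈ sepSurjRankFamily A) ∧
  (∀ C : NonUnitalStarSubalgebra ℂ A, IsClosed (C : Set A) →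
    TopologicalSpace.SeparableSpace C → ∃ B ∈ sepSurjRankFamily A, C ≤ B)

end

section PureStates

open scoped ComplexOrder InnerProductSpace

variable {B : Type*} [CStarAlgebra B] [PartialOrder B] [StarOrderedRing B]

/-- A positive element dominated, up to arbitrarily small scalars, by self-adjoint elements of a
closed ideal belongs to this ideal. -/
lemma mem_closedIdeal_of_le_add (K : Submodule ℂ B) (hK : IsClosed (K : Set B))
    (hl : ∀ b, ∀ k ∈ K, b * k ∈ K) (hr : ∀ b, ∀ k ∈ K, k * b ∈ K) {a : B} (ha : 0 ≤ a)
    (h : ∀ ε : ℝ, 0 < ε → ∃ k ∈ K, IsSelfAdjoint k ∧ a ≤ k + algebraMap ℝ B ε) : a ∈ K := by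
  suffices a ∈ closure (K : Set B) by rwa [hK.closure_eq] at this
  rw [Metric.mem_closure_iff]
  intro ε hε
  obtain ⟨k, hk, hks, hle⟩ := h (ε / 4) (by positivity)
  set η : ℝ := (ε / 4) ^ 2 with hη
  have hηpos : 0 < η := by positivity
  have hden : ∀ t : ℝ, t ^ 2 + η ≠ 0 := fun t => by positivity
  set u : B := cfc (fun t : ℝ => η / (t ^ 2 + η)) k with hu
  have hcu : Continuous (fun t : ℝ => η / (t ^ 2 + η)) := by fun_prop (disch := exact hden _)
  have hcg : Continuous (fun t : ℝ => t / (t ^ 2 + η)) := by fun_prop (disch := exact hden _)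
  have hus : IsSelfAdjoint u := cfc_predicate _ _
  have heK : 1 - u ∈ K := by
    have : 1 - u = k * cfc (fun t : ℝ => t / (t ^ 2 + η)) k := by
      have h1 : k * cfc (fun t : ℝ => t / (t ^ 2 + η)) k
          = cfc (fun t : ℝ => t * (t / (t ^ 2 + η))) k := by
        rw [cfc_mul _ _ k (by fun_prop) hcg.continuousOn, cfc_id' ℝ k]
      rw [h1, ← cfc_one ℝ k, hu, ← cfc_sub _ _ k (by fun_prop) hcu.continuousOn]
      congr 1
      ext t
      have := hden t
      simp only [Pi.one_apply]
      field_simp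
      ring
    rw [this]
    exact hr _ _ hk
  refine ⟨a - u * a * u, ?_, ?_⟩
  · have : a - u * a * u = (1 - u) * a + u * (a * (1 - u)) := by noncomm_ring
    rw [this]
    exact K.add_mem (hr _ _ heK) (hl _ _ (hl _ _ heK))
  · rw [dist_eq_norm, sub_sub_cancel]
    have h1 : u * a * u ≤ u * (k + algebraMap ℝ B (ε / 4)) * u := by
      simpa [hus.star_eq] using star_right_conjugate_le_conjugate hle u
    have h0 : 0 ≤ u * a * u := by
      simpa [hus.star_eq] using star_right_conjugate_le_conjugate ha u
    refine (CStarAlgebra.norm_le_norm_of_nonneg_of_le h0 h1).trans_lt ?_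
    have h2 : u * (k + algebraMap ℝ B (ε / 4)) * u
        = cfc (fun t : ℝ => η / (t ^ 2 + η) * (t + ε / 4) * (η / (t ^ 2 + η))) k := by
      rw [cfc_mul _ _ k (by fun_prop (disch := exact hden _)) hcu.continuousOn,
        cfc_mul _ _ k hcu.continuousOn (by fun_prop), cfc_add_const _ _ k (by fun_prop),
        cfc_id' ℝ k]
    rw [h2]
    refine (norm_cfc_le (c := ε / 4 + ε / 4) (by positivity) ?_).trans_lt (by linarith)
    intro t _
    have hd : 0 < t ^ 2 + η := by positivity
    have hv1 : η / (t ^ 2 + η) ≤ 1 := by rw [div_le_one hd]; nlinarith [sq_nonneg t]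
    have hv0 : 0 ≤ η / (t ^ 2 + η) := by positivity
    have hvt : η / (t ^ 2 + η) * |t| ≤ ε / 4 := by
      rw [div_mul_eq_mul_div, div_le_iff₀ hd, hη, ← sq_abs t]
      nlinarith [sq_nonneg (|t| - ε / 4), abs_nonneg t, mul_pos hε hε, mul_pos (mul_pos hε hε) hε,
        mul_nonneg hε.le (sq_nonneg (|t| - ε / 4)), mul_nonneg (mul_pos hε hε).le (abs_nonneg t),
        mul_nonneg hε.le (sq_nonneg |t|)]
    rw [Real.norm_eq_abs, abs_mul, abs_mul, abs_of_nonneg hv0]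
    have h3 : |t + ε / 4| ≤ |t| + ε / 4 :=
      (abs_add_le _ _).trans (by rw [abs_of_pos (by positivity : 0 < ε / 4)])
    calc η / (t ^ 2 + η) * |t + ε / 4| * (η / (t ^ 2 + η))
        ≤ η / (t ^ 2 + η) * (|t| + ε / 4) * 1 := by gcongr
      _ ≤ ε / 4 + ε / 4 := by nlinarith

/-- The states of a unital C*-algebra which vanish on a given subspace. -/
def statesVanishingOn (K : Submodule ℂ B) : Set (WeakDual ℂ B) :=
  {φ | (∀ b : B, 0 ≤ b → 0 ≤ φ b) ∧ φ 1 = 1 ∧ ∀ k ∈ K, φ k = 0}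

lemma convex_statesVanishingOn (K : Submodule ℂ B) : Convex ℝ (statesVanishingOn K) := by
  rintro φ ⟨h1, h2, h3⟩ ψ ⟨g1, g2, g3⟩ s t hs ht hst
  have happ : ∀ b, (s • φ + t • ψ : WeakDual ℂ B) b = (s : ℂ) * φ b + (t : ℂ) * ψ b := by
    intro b
    change s • φ b + t • ψ b = _
    simp
  refine ⟨fun b hb => ?_, ?_, fun k hk => ?_⟩
  · rw [happ]
    have hs' : (0 : ℂ) ≤ s := by exact_mod_cast hs
    have ht' : (0 : ℂ) ≤ t := by exact_mod_cast ht
    exact add_nonneg (mul_nonneg hs' (h1 b hb)) (mul_nonneg ht' (g1 b hb))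
  · rw [happ, h2, g2, mul_one, mul_one]
    exact_mod_cast hst
  · rw [happ, h3 k hk, g3 k hk]; simp

/-- The positive linear functional underlying a positive element of the weak dual. -/
noncomputable def positiveOfWeakDual (φ : WeakDual ℂ B) (h : ∀ b : B, 0 ≤ b → 0 ≤ φ b) :
    B →ₚ[ℂ] ℂ :=
  PositiveLinearMap.mk₀ (WeakDual.toStrongDual φ).toLinearMap h

lemma positiveOfWeakDual_apply (φ : WeakDual ℂ B) (h : ∀ b : B, 0 ≤ b → 0 ≤ φ b) (b : B) :
    positiveOfWeakDual φ h b = φ b := rfl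

lemma norm_apply_le_of_state (φ : WeakDual ℂ B) (h : ∀ b : B, 0 ≤ b → 0 ≤ φ b) (h1 : φ 1 = 1)
    (b : B) : ‖φ b‖ ≤ ‖b‖ := by
  set f := positiveOfWeakDual φ h with hf
  have hC := norm_inner_le_norm (𝕜 := ℂ) (f.toPreGNS 1) (f.toPreGNS b)
  rw [f.preGNS_inner_def] at hC
  have e1 : ‖f.toPreGNS 1‖ = 1 := by
    have := f.preGNS_norm_sq (f.toPreGNS 1)
    simp only [PositiveLinearMap.ofPreGNS_toPreGNS, star_one, mul_one] at this
    rw [hf, positiveOfWeakDual_apply, h1] at this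
    have h2 : ‖f.toPreGNS 1‖ ^ 2 = 1 := by exact_mod_cast this
    nlinarith [norm_nonneg (f.toPreGNS 1)]
  have e2 : ‖f.toPreGNS b‖ ≤ ‖b‖ := by
    have := f.preGNS_norm_sq (f.toPreGNS b)
    simp only [PositiveLinearMap.ofPreGNS_toPreGNS] at this
    have h3 : star b * b ≤ algebraMap ℝ B (‖b‖ ^ 2) := by
      have := IsSelfAdjoint.le_algebraMap_norm_self (IsSelfAdjoint.star_mul_self b)
      rwa [CStarRing.norm_star_mul_self, ← sq] at this
    have h4 : f (star b * b) ≤ f (algebraMap ℝ B (‖b‖ ^ 2)) := OrderHomClass.mono f h3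
    have h5 : f (algebraMap ℝ B (‖b‖ ^ 2)) = ((‖b‖ ^ 2 : ℝ) : ℂ) := by
      rw [Algebra.algebraMap_eq_smul_one, ← Complex.coe_smul, map_smul, hf,
        positiveOfWeakDual_apply, h1]
      simp
    rw [← this, h5] at h4
    have h6 : ‖f.toPreGNS b‖ ^ 2 ≤ ‖b‖ ^ 2 := by exact_mod_cast h4
    exact (sq_le_sq₀ (norm_nonneg _) (norm_nonneg _)).1 h6
  simp only [PositiveLinearMap.ofPreGNS_toPreGNS, star_one, one_mul, e1] at hC
  exact hC.trans e2

lemma isCompact_statesVanishingOn (K : Submodule ℂ B) : IsCompact (statesVanishingOn K) := by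
  refine (WeakDual.isCompact_closedBall (𝕜 := ℂ) (E := B) 0 1).of_isClosed_subset ?_ ?_
  · have : statesVanishingOn K = (⋂ (b : B) (_ : 0 ≤ b), {φ : WeakDual ℂ B | 0 ≤ φ b}) ∩
        ({φ : WeakDual ℂ B | φ 1 = 1} ∩ ⋂ k ∈ K, {φ : WeakDual ℂ B | φ k = 0}) := by
      ext φ; simp [statesVanishingOn]
    rw [this]
    refine (isClosed_iInter fun b => isClosed_iInter fun _ => ?_).inter
      (IsClosed.inter ?_ (isClosed_iInter fun k => isClosed_iInter fun _ => ?_))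
    · exact isClosed_le continuous_const (WeakDual.eval_continuous b)
    · exact isClosed_eq (WeakDual.eval_continuous 1) continuous_const
    · exact isClosed_eq (WeakDual.eval_continuous k) continuous_const
  · rintro φ ⟨h1, h2, -⟩
    simp only [Set.mem_preimage, mem_closedBall_zero_iff]
    refine ContinuousLinearMap.opNorm_le_bound _ zero_le_one fun b => ?_
    simpa using norm_apply_le_of_state φ h1 h2 b

end PureStates

section IrreducibleRepresentations

open scoped ComplexOrder InnerProductSpace

variable {B : Type*} [CStarAlgebra B] [PartialOrder B] [StarOrderedRing B]

lemma exists_state_vanishingOn_ne_zero (K : Submodule ℂ B) (hK : IsClosed (K : Set B))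
    (hl : ∀ b, ∀ k ∈ K, b * k ∈ K) (hr : ∀ b, ∀ k ∈ K, k * b ∈ K) (hs : ∀ k ∈ K, star k ∈ K)
    {a : B} (ha : 0 ≤ a) (haK : a ∉ K) : ∃ φ ∈ statesVanishingOn K, φ a ≠ 0 := by
  set s : Set B := {x | ∃ p k : B, 0 ≤ p ∧ k ∈ K ∧ x = p + k} with hsdef
  have hconv : Convex ℝ s := by
    rintro _ ⟨p, k, hp, hk, rfl⟩ _ ⟨q, l, hq, hl', rfl⟩ c d hc hd -
    refine ⟨c • p + d • q, (c : ℂ) • k + (d : ℂ) • l, add_nonneg (smul_nonneg hc hp)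
      (smul_nonneg hd hq), K.add_mem (K.smul_mem _ hk) (K.smul_mem _ hl'), ?_⟩
    simp only [Complex.coe_smul, smul_add]
    abel
  have hna : -a ∉ closure s := by
    intro hmem
    apply haK
    refine mem_closedIdeal_of_le_add K hK hl hr ha fun ε hε => ?_
    obtain ⟨_, ⟨p, k, hp, hk, rfl⟩, hd⟩ := Metric.mem_closure_iff.1 hmem ε hε
    set k' : B := (2⁻¹ : ℝ) • (k + star k) with hk'
    have hk's : IsSelfAdjoint k' := by
      rw [isSelfAdjoint_iff, hk', star_smul, star_add, star_star, add_comm (star k)]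
      simp
    have hk'K : k' ∈ K := by
      rw [hk', ← Complex.coe_smul]
      exact K.smul_mem _ (K.add_mem hk (hs k hk))
    refine ⟨-k', K.neg_mem hk'K, hk's.neg, ?_⟩
    have hnorm : ‖a + p + k'‖ ≤ ε := by
      have e1 : a + p + k' = (2⁻¹ : ℝ) • ((a + p + k) + star (a + p + k)) := by
        rw [star_add, star_add, ha.star_eq, hp.star_eq, hk']
        module
      rw [dist_eq_norm] at hd
      have e2 : ‖a + p + k‖ ≤ ε := by
        rw [← norm_neg]
        refine le_trans (le_of_eq ?_) hd.le
        congr 1; abel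
      rw [e1, norm_smul]
      have e3 := norm_add_le (a + p + k) (star (a + p + k))
      rw [norm_star] at e3
      rw [Real.norm_of_nonneg (by norm_num)]
      linarith
    have hsa : IsSelfAdjoint (a + p + k') :=
      ((IsSelfAdjoint.of_nonneg ha).add (IsSelfAdjoint.of_nonneg hp)).add hk's
    have h1 := hsa.le_algebraMap_norm_self
    have h2 : algebraMap ℝ B ‖a + p + k'‖ ≤ algebraMap ℝ B ε := algebraMap_mono B hnorm
    have h3 : a + k' ≤ algebraMap ℝ B ε :=
      le_trans (by rw [add_right_comm]; exact le_add_of_nonneg_right hp) (h1.trans h2)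
    rw [neg_add_eq_sub]
    exact le_sub_iff_add_le.2 h3
  obtain ⟨f, u, hfu, hfs⟩ := RCLike.geometric_hahn_banach_point_closed (𝕜 := ℂ) hconv.closure
    isClosed_closure hna
  have hmem : ∀ p k : B, 0 ≤ p → k ∈ K → u < (f (p + k)).re := fun p k hp hk =>
    hfs _ (subset_closure ⟨p, k, hp, hk, rfl⟩)
  have hu0 : u < 0 := by simpa using hmem 0 0 le_rfl K.zero_mem
  have hfp : ∀ p : B, 0 ≤ p → 0 ≤ (f p).re := by
    intro p hp
    by_contra! hlt
    have := hmem ((u / (f p).re) • p) 0 (smul_nonneg (div_nonneg_of_nonpos hu0.le hlt.le) hp)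
      K.zero_mem
    rw [add_zero, ← Complex.coe_smul, map_smul, smul_eq_mul, Complex.re_ofReal_mul,
      div_mul_cancel₀ _ hlt.ne] at this
    exact lt_irrefl _ this
  have hfkre : ∀ k ∈ K, (f k).re = 0 := by
    intro k hk
    by_contra hne
    have := hmem 0 (((u / (f k).re : ℝ) : ℂ) • k) le_rfl (K.smul_mem _ hk)
    rw [zero_add, map_smul, smul_eq_mul, Complex.re_ofReal_mul, div_mul_cancel₀ _ hne] at this
    exact lt_irrefl _ this
  have hfk : ∀ k ∈ K, f k = 0 := by
    intro k hk
    refine Complex.ext (hfkre k hk) ?_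
    have := hfkre _ (K.smul_mem Complex.I hk)
    simpa using this
  have hfa : 0 < (f a).re := by
    have : (f (-a)).re < u := hfu
    rw [map_neg, Complex.neg_re] at this
    linarith
  -- the hermitian part of `f`
  let g : B →L[ℂ] ℂ :=
    { toFun := fun b => (2⁻¹ : ℂ) * (f b + star (f (star b)))
      map_add' := fun x y => by simp only [map_add, star_add]; ring
      map_smul' := fun c x => by
        simp only [map_smul, star_smul, smul_eq_mul, star_mul', RingHom.id_apply, star_star]; ring
      cont := by fun_prop }
  have hg : ∀ b, g b = (2⁻¹ : ℂ) * (f b + star (f (star b))) := fun _ => rfl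
  have hgsa : ∀ b : B, IsSelfAdjoint b → g b = ((f b).re : ℂ) := by
    intro b hb
    rw [hg, hb.star_eq]
    refine Complex.ext ?_ ?_
    · simp only [Complex.mul_re, Complex.add_re, Complex.star_def, Complex.conj_re]
      norm_num
      ring
    · simp
  have h1pos : 0 < (f 1).re := by
    refine lt_of_le_of_ne (hfp 1 zero_le_one) fun h0 => ?_
    have h2 := (IsSelfAdjoint.of_nonneg ha).le_algebraMap_norm_self
    have h3 := hfp _ (sub_nonneg.2 h2)
    rw [map_sub, Algebra.algebraMap_eq_smul_one, ← Complex.coe_smul, map_smul, Complex.sub_re,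
      smul_eq_mul, Complex.re_ofReal_mul, ← h0, mul_zero] at h3
    linarith
  refine ⟨StrongDual.toWeakDual (((f 1).re⁻¹ : ℂ) • g), ⟨fun b hb => ?_, ?_, fun k hk => ?_⟩, ?_⟩
  · change 0 ≤ ((f 1).re⁻¹ : ℂ) * g b
    rw [hgsa b (IsSelfAdjoint.of_nonneg hb)]
    exact_mod_cast mul_nonneg (inv_nonneg.2 h1pos.le) (hfp b hb)
  · change ((f 1).re⁻¹ : ℂ) * g 1 = 1
    rw [hgsa 1 (IsSelfAdjoint.one B)]
    exact inv_mul_cancel₀ (by exact_mod_cast h1pos.ne')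
  · change ((f 1).re⁻¹ : ℂ) * g k = 0
    rw [hg, hfk k hk, hfk _ (hs k hk)]
    simp
  · change ((f 1).re⁻¹ : ℂ) * g a ≠ 0
    rw [hgsa a (IsSelfAdjoint.of_nonneg ha)]
    exact_mod_cast mul_ne_zero (inv_ne_zero h1pos.ne') hfa.ne'

lemma exists_extreme_state_ne_zero (K : Submodule ℂ B) (hK : IsClosed (K : Set B))
    (hl : ∀ b, ∀ k ∈ K, b * k ∈ K) (hr : ∀ b, ∀ k ∈ K, k * b ∈ K) (hs : ∀ k ∈ K, star k ∈ K)
    {a : B} (ha : 0 ≤ a) (haK : a ∉ K) :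
    ∃ φ ∈ (statesVanishingOn K).extremePoints ℝ, φ a ≠ 0 := by
  obtain ⟨ψ, hψ, hψa⟩ := exists_state_vanishingOn_ne_zero K hK hl hr hs ha haK
  by_contra! hcon
  have hcs : ContinuousSMul ℝ (WeakDual ℂ B) :=
    ⟨(Complex.continuous_ofReal.comp continuous_fst).smul continuous_snd⟩
  have hlc : LocallyConvexSpace ℝ (WeakDual ℂ B) :=
    WeakBilin.locallyConvexSpace (𝕜 := ℂ) (B := topDualPairing ℂ B)
  have hkm := @closure_convexHull_extremePoints (WeakDual ℂ B) _ _ _ _ _ hcs hlc _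
    (isCompact_statesVanishingOn K) (convex_statesVanishingOn K)
  have hψ' : ψ ∈ closure (convexHull ℝ ((statesVanishingOn K).extremePoints ℝ)) :=
    hkm.symm.subset hψ
  have hsub : closure (convexHull ℝ ((statesVanishingOn K).extremePoints ℝ)) ⊆
      {φ : WeakDual ℂ B | φ a = 0} := by
    refine closure_minimal (convexHull_min (fun φ hφ => hcon φ hφ) ?_)
      (isClosed_eq (WeakDual.eval_continuous a) continuous_const)
    intro φ hφ χ hχ s t _ _ _
    change s • φ a + t • χ a = 0
    rw [show φ a = 0 from hφ, show χ a = 0 from hχ]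
    simp
  exact hψa (hsub hψ')

end IrreducibleRepresentations

section IrreducibleRepresentations

open scoped ComplexOrder InnerProductSpace

variable {B : Type*} [CStarAlgebra B] [PartialOrder B] [StarOrderedRing B]
variable {H : Type*} [NormedAddCommGroup H] [InnerProductSpace ℂ H] [CompleteSpace H]

/-- The vector functional `b ↦ ⟪v, π b v⟫` of a representation. -/
noncomputable def vectorFunctional (π : B →⋆ₐ[ℂ] (H →L[ℂ] H)) (v : H) : WeakDual ℂ B :=
  StrongDual.toWeakDual <| LinearMap.mkContinuous
    { toFun := fun b => ⟪v, π b v⟫_ℂ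
      map_add' := fun b c => by simp
      map_smul' := fun r b => by simp } (‖v‖ * ‖v‖) fun b => by
    refine (norm_inner_le_norm v (π b v)).trans ?_
    have h1 := (π b).le_opNorm v
    have h2 := NonUnitalStarAlgHom.norm_apply_le π b
    calc ‖v‖ * ‖π b v‖ ≤ ‖v‖ * (‖π b‖ * ‖v‖) := by gcongr
      _ ≤ ‖v‖ * (‖b‖ * ‖v‖) := by gcongr
      _ = ‖v‖ * ‖v‖ * ‖b‖ := by ring

lemma vectorFunctional_apply (π : B →⋆ₐ[ℂ] (H →L[ℂ] H)) (v : H) (b : B) :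
    vectorFunctional π v b = ⟪v, π b v⟫_ℂ := rfl

lemma inner_map_star (π : B →⋆ₐ[ℂ] (H →L[ℂ] H)) (b : B) (v w : H) :
    ⟪v, π (star b) w⟫_ℂ = ⟪π b v, w⟫_ℂ := by
  rw [map_star, ContinuousLinearMap.star_eq_adjoint, ContinuousLinearMap.adjoint_inner_right]

lemma normalized_vectorFunctional_mem (K : Submodule ℂ B) (π : B →⋆ₐ[ℂ] (H →L[ℂ] H))
    (hπ : ∀ k ∈ K, π k = 0) {v : H} (hv : v ≠ 0) :
    (((‖v‖ ^ 2)⁻¹ : ℝ) • vectorFunctional π v) ∈ statesVanishingOn K := by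
  have happ : ∀ b, (((‖v‖ ^ 2)⁻¹ : ℝ) • vectorFunctional π v) b
      = (((‖v‖ ^ 2)⁻¹ : ℝ) : ℂ) * ⟪v, π b v⟫_ℂ := by
    intro b
    change ((‖v‖ ^ 2)⁻¹ : ℝ) • (vectorFunctional π v) b = _
    rw [vectorFunctional_apply, Complex.real_smul]
  have hv' : ‖v‖ ≠ 0 := norm_ne_zero_iff.2 hv
  refine ⟨fun b hb => ?_, ?_, fun k hk => ?_⟩
  · rw [happ]
    refine mul_nonneg (by exact_mod_cast inv_nonneg.2 (sq_nonneg _)) ?_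
    obtain ⟨c, rfl⟩ := CStarAlgebra.nonneg_iff_eq_star_mul_self.1 hb
    rw [map_mul, mul_apply_eq_comp, inner_map_star, inner_self_eq_norm_sq_to_K]
    simp
  · rw [happ, map_one, one_apply_eq_self, inner_self_eq_norm_sq_to_K]
    have : (‖v‖ : ℂ) ≠ 0 := by exact_mod_cast hv'
    push_cast
    exact inv_mul_cancel₀ (pow_ne_zero 2 this)
  · rw [happ, hπ k hk]
    simp

/-- The cyclic representation of an extreme state is irreducible. -/
lemma eq_bot_or_eq_top_of_extreme (K : Submodule ℂ B) (π : B →⋆ₐ[ℂ] (H →L[ℂ] H))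
    (hπ : ∀ k ∈ K, π k = 0) (ξ : H) (hξ : ‖ξ‖ = 1) (hd : DenseRange fun b => π b ξ)
    (hex : vectorFunctional π ξ ∈ (statesVanishingOn K).extremePoints ℝ)
    (M : Submodule ℂ H) (hM : IsClosed (M : Set H)) (hinv : ∀ b, ∀ v ∈ M, π b v ∈ M) :
    M = ⊥ ∨ M = ⊤ := by
  have : CompleteSpace M := hM.completeSpace_coe
  set p : H := M.starProjection ξ with hp
  set q : H := ξ - p with hq
  have hpM : p ∈ M := M.starProjection_apply_mem ξ
  have hqM : q ∈ Mᗮ := M.sub_starProjection_mem_orthogonal ξ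
  have hinv' : ∀ b, ∀ v ∈ Mᗮ, π b v ∈ Mᗮ := by
    intro b v hv
    rw [Submodule.mem_orthogonal] at hv ⊢
    intro u hu
    have := hv _ (hinv (star b) u hu)
    rwa [← inner_map_star, star_star] at this
  have hpq : p + q = ξ := by rw [hq]; abel
  have hξM : ξ ∈ M → M = ⊤ := by
    intro h
    rw [eq_top_iff]
    intro v _
    have hsub : Set.range (fun b => π b ξ) ⊆ M := by
      rintro _ ⟨b, rfl⟩; exact hinv b ξ h
    exact hM.closure_subset_iff.2 hsub (hd v)
  have hsplit : ∀ b, ⟪ξ, π b ξ⟫_ℂ = ⟪p, π b p⟫_ℂ + ⟪q, π b q⟫_ℂ := by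
    intro b
    have e1 : ⟪p, π b q⟫_ℂ = 0 := Submodule.inner_right_of_mem_orthogonal hpM (hinv' b q hqM)
    have e2 : ⟪q, π b p⟫_ℂ = 0 := Submodule.inner_left_of_mem_orthogonal (hinv b p hpM) hqM
    rw [← hpq, map_add, inner_add_left, inner_add_right, inner_add_right, e1, e2]
    ring
  by_cases hp0 : p = 0
  · left
    rw [eq_bot_iff]
    intro v hv
    have hξ' : ξ ∈ Mᗮ := by rw [← hpq, hp0, zero_add]; exact hqM
    have hsub : Set.range (fun b => π b ξ) ⊆ Mᗮ := by
      rintro _ ⟨b, rfl⟩; exact hinv' b ξ hξ'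
    have : v ∈ Mᗮ := M.isClosed_orthogonal.closure_subset_iff.2 hsub (hd v)
    exact (Submodule.mem_bot ℂ).2 (inner_self_eq_zero.1
      (Submodule.inner_right_of_mem_orthogonal hv this))
  right
  apply hξM
  by_cases hq0 : q = 0
  · rw [← hpq, hq0, add_zero]; exact hpM
  have hnp : 0 < ‖p‖ := norm_pos_iff.2 hp0
  have hnq : 0 < ‖q‖ := norm_pos_iff.2 hq0
  have hsum : ‖p‖ ^ 2 + ‖q‖ ^ 2 = 1 := by
    have := hsplit 1
    simp only [map_one, one_apply_eq_self, inner_self_eq_norm_sq_to_K, hξ] at this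
    have h2 : ((‖p‖ ^ 2 + ‖q‖ ^ 2 : ℝ) : ℂ) = ((1 : ℝ) : ℂ) := by push_cast; simpa using this.symm
    exact_mod_cast h2
  rw [mem_extremePoints] at hex
  have key := (hex.2 _ (normalized_vectorFunctional_mem K π hπ hp0) _
    (normalized_vectorFunctional_mem K π hπ hq0) ⟨‖p‖ ^ 2, ‖q‖ ^ 2, by positivity, by positivity,
      hsum, ?_⟩).1
  · have hall : ∀ b, ⟪p - ((‖p‖ ^ 2 : ℝ) : ℂ) • ξ, π b ξ⟫_ℂ = 0 := by
      intro b
      have h1 : (((‖p‖ ^ 2)⁻¹ : ℝ) • vectorFunctional π p) b = vectorFunctional π ξ b := by rw [key]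
      have h2 : (((‖p‖ ^ 2)⁻¹ : ℝ) • vectorFunctional π p) b
          = (((‖p‖ ^ 2)⁻¹ : ℝ) : ℂ) * ⟪p, π b p⟫_ℂ := by
        change ((‖p‖ ^ 2)⁻¹ : ℝ) • (vectorFunctional π p) b = _
        rw [vectorFunctional_apply, Complex.real_smul]
      rw [h2, vectorFunctional_apply] at h1
      have e1 : ⟪p, π b q⟫_ℂ = 0 := Submodule.inner_right_of_mem_orthogonal hpM (hinv' b q hqM)
      have e3 : ⟪p, π b ξ⟫_ℂ = ⟪p, π b p⟫_ℂ := by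
        rw [← hpq, map_add, inner_add_right, e1, add_zero]
      rw [inner_sub_left, inner_smul_left, e3, ← h1]
      have : (‖p‖ : ℂ) ≠ 0 := by exact_mod_cast hnp.ne'
      simp only [Complex.conj_ofReal]
      push_cast
      field_simp
      ring
    have hzero : p - ((‖p‖ ^ 2 : ℝ) : ℂ) • ξ = 0 :=
      hd.eq_zero_of_inner_left ℂ hall
    have : ξ = (((‖p‖ ^ 2)⁻¹ : ℝ) : ℂ) • p := by
      have hne : ((‖p‖ ^ 2 : ℝ) : ℂ) ≠ 0 := by exact_mod_cast (pow_pos hnp 2).ne'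
      rw [Complex.ofReal_inv, eq_inv_smul_iff₀ hne]
      exact (sub_eq_zero.1 hzero).symm
    rw [this]
    exact M.smul_mem _ hpM
  · refine ContinuousLinearMap.ext fun b => ?_
    change (‖p‖ ^ 2) • (((‖p‖ ^ 2)⁻¹ : ℝ) • (vectorFunctional π p) b) +
      (‖q‖ ^ 2) • (((‖q‖ ^ 2)⁻¹ : ℝ) • (vectorFunctional π q) b) = vectorFunctional π ξ b
    rw [smul_smul, smul_smul, mul_inv_cancel₀ (by positivity), mul_inv_cancel₀ (by positivity),
      one_smul, one_smul, vectorFunctional_apply, vectorFunctional_apply, vectorFunctional_apply,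
      hsplit]

/-- A closed ideal of a unital C*-algebra and an element outside of it are separated by an
irreducible representation. -/
lemma exists_irreducible_of_notMem_unital {B : Type*} [CStarAlgebra B] [PartialOrder B]
    [StarOrderedRing B] (K : Submodule ℂ B) (hK : IsClosed (K : Set B))
    (hl : ∀ b, ∀ k ∈ K, b * k ∈ K) (hr : ∀ b, ∀ k ∈ K, k * b ∈ K) (hs : ∀ k ∈ K, star k ∈ K)
    {a : B} (ha : 0 ≤ a) (haK : a ∉ K) :
    ∃ (f : B →ₚ[ℂ] ℂ), (∀ k ∈ K, f.gnsStarAlgHom k = 0) ∧ f.gnsStarAlgHom a ≠ 0 ∧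
      ∀ M : Submodule ℂ f.GNS, IsClosed (M : Set f.GNS) →
        (∀ b, ∀ v ∈ M, f.gnsStarAlgHom b v ∈ M) → M = ⊥ ∨ M = ⊤ := by
  obtain ⟨φ, hφ, hφa⟩ := exists_extreme_state_ne_zero K hK hl hr hs ha haK
  have hφs : φ ∈ statesVanishingOn K := hφ.1
  obtain ⟨hpos, hone, hvan⟩ := hφs
  set f := positiveOfWeakDual φ hpos with hf
  set ξ : f.GNS := ((f.toPreGNS 1 : f.PreGNS) : f.GNS) with hξdef
  have hπξ : ∀ b, f.gnsStarAlgHom b ξ = ((f.toPreGNS b : f.PreGNS) : f.GNS) := by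
    intro b
    change f.gnsNonUnitalStarAlgHom b ξ = _
    rw [hξdef, PositiveLinearMap.gnsNonUnitalStarAlgHom_apply_coe]
    congr 1
    change f.toPreGNS (b * 1) = _
    rw [mul_one]
  have hvec : vectorFunctional f.gnsStarAlgHom ξ = φ := by
    refine ContinuousLinearMap.ext fun b => ?_
    change vectorFunctional f.gnsStarAlgHom ξ b = φ b
    rw [vectorFunctional_apply, hπξ, hξdef, UniformSpace.Completion.inner_coe,
      PositiveLinearMap.preGNS_inner_def]
    simp only [PositiveLinearMap.ofPreGNS_toPreGNS, star_one, one_mul]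
    rfl
  have hd : DenseRange fun b => f.gnsStarAlgHom b ξ := by
    have : (fun b => f.gnsStarAlgHom b ξ) = (fun b : f.PreGNS => (b : f.GNS)) ∘ f.toPreGNS := by
      funext b; exact hπξ b
    rw [this]
    exact UniformSpace.Completion.denseRange_coe.comp f.toPreGNS.surjective.denseRange
      (UniformSpace.Completion.continuous_coe _)
  have hk : ∀ k ∈ K, f.gnsStarAlgHom k = 0 := by
    intro k hk
    have h0 : ∀ b, f.gnsStarAlgHom k (f.gnsStarAlgHom b ξ) = 0 := by
      intro b
      rw [← mul_apply_eq_comp, ← map_mul, ← inner_self_eq_zero (𝕜 := ℂ), ← inner_map_star,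
        ← mul_apply_eq_comp, ← map_mul, ← vectorFunctional_apply, hvec]
      exact hvan _ (hl _ _ (hr _ _ hk))
    ext v
    have : v ∈ closure (Set.range fun b => f.gnsStarAlgHom b ξ) := hd v
    have hsub : closure (Set.range fun b => f.gnsStarAlgHom b ξ) ⊆
        {v | f.gnsStarAlgHom k v = 0} := by
      refine closure_minimal ?_ (isClosed_eq (f.gnsStarAlgHom k).continuous continuous_const)
      rintro _ ⟨b, rfl⟩; exact h0 b
    exact hsub this
  refine ⟨f, hk, fun h0 => hφa ?_, fun M hM hinv => ?_⟩
  · rw [← hvec, vectorFunctional_apply, h0]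
    simp
  · have hnorm : ‖ξ‖ = 1 := by
      have h1 : vectorFunctional f.gnsStarAlgHom ξ 1 = 1 := by rw [hvec, hone]
      rw [vectorFunctional_apply, map_one, one_apply_eq_self, inner_self_eq_norm_sq_to_K] at h1
      have h2 : ((‖ξ‖ ^ 2 : ℝ) : ℂ) = ((1 : ℝ) : ℂ) := by simpa using h1
      have h3 : ‖ξ‖ ^ 2 = 1 := by exact_mod_cast h2
      nlinarith [norm_nonneg ξ]
    exact eq_bot_or_eq_top_of_extreme K f.gnsStarAlgHom hk ξ hnorm hd (by rwa [hvec]) M hM hinv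

end IrreducibleRepresentations

section ClosedIdeals

variable {B : Type*} [CStarAlgebra B]

lemma mem_of_star_mul_self_mem_unital (K : Submodule ℂ B) (hK : IsClosed (K : Set B))
    (hl : ∀ b, ∀ k ∈ K, b * k ∈ K) (hr : ∀ b, ∀ k ∈ K, k * b ∈ K) {z : B}
    (hz : star z * z ∈ K) : z ∈ K := by
  suffices z ∈ closure (K : Set B) by rwa [hK.closure_eq] at this
  rw [Metric.mem_closure_iff]
  intro ε hε
  set h : B := star z * z with hh
  have hhs : IsSelfAdjoint h := IsSelfAdjoint.star_mul_self z
  set η : ℝ := (ε ^ 2 / 2) ^ 2 with hη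
  have hηpos : 0 < η := by positivity
  have hden : ∀ t : ℝ, t ^ 2 + η ≠ 0 := fun t => by positivity
  set u : B := cfc (fun t : ℝ => η / (t ^ 2 + η)) h with hu
  have hcu : Continuous (fun t : ℝ => η / (t ^ 2 + η)) := by fun_prop (disch := exact hden _)
  have hcg : Continuous (fun t : ℝ => t / (t ^ 2 + η)) := by fun_prop (disch := exact hden _)
  have hus : IsSelfAdjoint u := cfc_predicate _ _
  have heK : 1 - u ∈ K := by
    have : 1 - u = h * cfc (fun t : ℝ => t / (t ^ 2 + η)) h := by
      have h1 : h * cfc (fun t : ℝ => t / (t ^ 2 + η)) h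
          = cfc (fun t : ℝ => t * (t / (t ^ 2 + η))) h := by
        rw [cfc_mul _ _ h (by fun_prop) hcg.continuousOn, cfc_id' ℝ h]
      rw [h1, ← cfc_one ℝ h, hu, ← cfc_sub _ _ h (by fun_prop) hcu.continuousOn]
      congr 1
      ext t
      have := hden t
      simp only [Pi.one_apply]
      field_simp
      ring
    rw [this]
    exact hr _ _ hz
  refine ⟨z * (1 - u), hl _ _ heK, ?_⟩
  rw [dist_eq_norm]
  have e1 : z - z * (1 - u) = z * u := by noncomm_ring
  rw [e1]
  have e2 : ‖z * u‖ * ‖z * u‖ < ε * ε := by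
    rw [← CStarRing.norm_star_mul_self, star_mul, hus.star_eq]
    have e3 : u * star z * (z * u)
        = cfc (fun t : ℝ => η / (t ^ 2 + η) * t * (η / (t ^ 2 + η))) h := by
      rw [cfc_mul _ _ h (by fun_prop (disch := exact hden _)) hcu.continuousOn,
        cfc_mul _ _ h hcu.continuousOn (by fun_prop), cfc_id' ℝ h, ← hu, hh]
      noncomm_ring
    rw [e3]
    refine (norm_cfc_le (c := ε ^ 2 / 2) (by positivity) ?_).trans_lt (by nlinarith)
    intro t _
    have hd : 0 < t ^ 2 + η := by positivity
    have hv1 : η / (t ^ 2 + η) ≤ 1 := by rw [div_le_one hd]; nlinarith [sq_nonneg t]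
    have hv0 : 0 ≤ η / (t ^ 2 + η) := by positivity
    have hvt : η / (t ^ 2 + η) * |t| ≤ ε ^ 2 / 2 := by
      rw [div_mul_eq_mul_div, div_le_iff₀ hd, hη, ← sq_abs t]
      set d := ε ^ 2 / 2
      have hd0 : 0 < d := by positivity
      nlinarith [mul_nonneg hd0.le (sq_nonneg (|t| - d)), abs_nonneg t,
        mul_nonneg (mul_pos hd0 hd0).le (abs_nonneg t)]
    rw [Real.norm_eq_abs, abs_mul, abs_mul, abs_of_nonneg hv0]
    calc η / (t ^ 2 + η) * |t| * (η / (t ^ 2 + η))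
        ≤ ε ^ 2 / 2 * 1 := by gcongr
      _ = ε ^ 2 / 2 := mul_one _
  exact lt_of_mul_self_lt_mul_self₀ hε.le e2

variable {A : Type*} [NonUnitalCStarAlgebra A]

namespace ClosedTwoSidedIdealC

/-- A closed ideal of a C*-algebra, seen as a subspace of the unitization. -/
noncomputable def toUnitization (K : ClosedTwoSidedIdealC A) : Submodule ℂ (Unitization ℂ A) :=
  Submodule.map (LinearMapClass.linearMap (Unitization.inrNonUnitalStarAlgHom ℂ A))
    K.carrier.toSubmodule

lemma mem_toUnitization (K : ClosedTwoSidedIdealC A) (x : Unitization ℂ A) :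
    x ∈ K.toUnitization ↔ ∃ k ∈ K.carrier, (k : Unitization ℂ A) = x := Iff.rfl

lemma inr_mem_toUnitization (K : ClosedTwoSidedIdealC A) (a : A) :
    (a : Unitization ℂ A) ∈ K.toUnitization ↔ a ∈ K.carrier := by
  rw [mem_toUnitization]
  exact ⟨fun ⟨k, hk, h⟩ => by rwa [← Unitization.inr_injective h], fun h => ⟨a, h, rfl⟩⟩

lemma isClosed_toUnitization (K : ClosedTwoSidedIdealC A) :
    IsClosed (K.toUnitization : Set (Unitization ℂ A)) :=
  (Unitization.isometry_inr (𝕜 := ℂ) (A := A)).isClosedEmbedding.isClosedMap _ K.isClosed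

lemma eq_algebraMap_add_inr (b : Unitization ℂ A) :
    b = algebraMap ℂ _ b.fst + (b.snd : Unitization ℂ A) :=
  (Unitization.inl_fst_add_inr_snd_eq b).symm

lemma mul_mem_left_toUnitization (K : ClosedTwoSidedIdealC A) (b : Unitization ℂ A) :
    ∀ x ∈ K.toUnitization, b * x ∈ K.toUnitization := by
  rintro _ ⟨k, hk, rfl⟩
  rw [mem_toUnitization]
  refine ⟨b.fst • k + b.snd * k,
    K.carrier.add_mem (K.carrier.smul_mem _ hk) (K.mul_mem_left _ _ hk), ?_⟩
  conv_rhs => rw [eq_algebraMap_add_inr b]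
  simp [add_mul, Algebra.algebraMap_eq_smul_one]

lemma mul_mem_right_toUnitization (K : ClosedTwoSidedIdealC A) (b : Unitization ℂ A) :
    ∀ x ∈ K.toUnitization, x * b ∈ K.toUnitization := by
  rintro _ ⟨k, hk, rfl⟩
  rw [mem_toUnitization]
  refine ⟨b.fst • k + k * b.snd,
    K.carrier.add_mem (K.carrier.smul_mem _ hk) (K.mul_mem_right _ _ hk), ?_⟩
  conv_rhs => rw [eq_algebraMap_add_inr b]
  simp [mul_add, Algebra.algebraMap_eq_smul_one]

lemma mem_of_star_mul_self_mem (K : ClosedTwoSidedIdealC A) {z : A}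
    (hz : star z * z ∈ K.carrier) : z ∈ K.carrier := by
  rw [← inr_mem_toUnitization] at hz ⊢
  rw [Unitization.inr_mul, Unitization.inr_star] at hz
  exact mem_of_star_mul_self_mem_unital _ K.isClosed_toUnitization K.mul_mem_left_toUnitization
    K.mul_mem_right_toUnitization hz

end ClosedTwoSidedIdealC

/-- A closed ideal of a C*-algebra and an element outside of it are separated by an irreducible
representation. -/
theorem exists_irreducibleRep_of_notMem.{u} {A : Type u} [NonUnitalCStarAlgebra A]
    (K : ClosedTwoSidedIdealC A) {z : A} (hz : z ∉ K.carrier) :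
    ∃ (H : Type u) (_ : NormedAddCommGroup H) (_ : InnerProductSpace ℂ H) (_ : CompleteSpace H)
      (π : A →⋆ₙₐ[ℂ] (H →L[ℂ] H)), IsIrreducibleRep π ∧ (∀ k ∈ K.carrier, π k = 0) ∧ π z ≠ 0 := by
  let _ := CStarAlgebra.spectralOrder (Unitization ℂ A)
  have := CStarAlgebra.spectralOrderedRing (Unitization ℂ A)
  have hz' : ((star z * z : A) : Unitization ℂ A) ∉ K.toUnitization := by
    rw [K.inr_mem_toUnitization]
    exact fun h => hz (K.mem_of_star_mul_self_mem h)
  have hstar : ∀ x ∈ K.toUnitization, star x ∈ K.toUnitization := by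
    rintro _ ⟨k, hk, rfl⟩
    exact ⟨star k, star_mem (s := K.carrier) hk, by simp⟩
  obtain ⟨f, hfK, hfz, hirr⟩ := exists_irreducible_of_notMem_unital K.toUnitization
    K.isClosed_toUnitization K.mul_mem_left_toUnitization K.mul_mem_right_toUnitization hstar
    (by rw [Unitization.inr_mul, Unitization.inr_star]; exact star_mul_self_nonneg _) hz'
  refine ⟨f.GNS, inferInstance, inferInstance, inferInstance,
    (f.gnsStarAlgHom : Unitization ℂ A →⋆ₙₐ[ℂ] _).comp (Unitization.inrNonUnitalStarAlgHom ℂ A),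
    ⟨⟨star z * z, hfz⟩, fun M hM hinv => hirr M hM fun b v hv => ?_⟩, fun k hk => ?_, fun h => ?_⟩
  · rw [ClosedTwoSidedIdealC.eq_algebraMap_add_inr b, map_add, AlgHomClass.commutes]
    refine M.add_mem ?_ (hinv b.snd v hv)
    rw [Algebra.algebraMap_eq_smul_one]
    exact M.smul_mem _ hv
  · exact hfK _ ⟨k, hk, rfl⟩
  · apply hfz
    have h' : f.gnsStarAlgHom (z : Unitization ℂ A) = 0 := h
    rw [Unitization.inr_mul, map_mul, h', mul_zero]

end ClosedIdeals

section CuntzComparison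

variable {T : Type*} [NonUnitalCStarAlgebra T]

theorem cuntzBelow_of_forall_norm_le {a b : T}
    (h : ∀ ε : ℝ, 0 < ε → ∃ r : T, ‖r * b * star r - a‖ ≤ ε) : CuntzBelow a b := by
  choose r hr using fun n : ℕ => h (1 / ((n : ℝ) + 1)) (by positivity)
  refine ⟨r, tendsto_iff_norm_sub_tendsto_zero.2 ?_⟩
  exact squeeze_zero (fun _ => norm_nonneg _) hr tendsto_one_div_add_atTop_nhds_zero_nat

theorem CuntzBelow.exists_norm_le {a b : T} (h : CuntzBelow a b) {ε : ℝ} (hε : 0 < ε) :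
    ∃ r : T, ‖r * b * star r - a‖ ≤ ε := by
  obtain ⟨r, hr⟩ := h
  obtain ⟨n, hn⟩ := (tendsto_iff_norm_sub_tendsto_zero.1 hr).eventually_le_const hε |>.exists
  exact ⟨r n, hn⟩

theorem cuntzBelow_conj (r a : T) : CuntzBelow (r * a * star r) a :=
  ⟨fun _ => r, tendsto_const_nhds⟩

variable [PartialOrder T] [StarOrderedRing T]

theorem cstarNonneg_iff {a : T} : CStarNonneg a ↔ 0 ≤ a :=
  CStarAlgebra.nonneg_iff_eq_star_mul_self.symm

theorem quasispectrum_nonneg' {a : T} (ha : 0 ≤ a) {t : ℝ} (ht : t ∈ quasispectrum ℝ a) : 0 ≤ t :=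
  quasispectrum_nonneg_of_nonneg a ha t ht

theorem exists_approx_mul_self {a : T} (ha : 0 ≤ a) {ε : ℝ} (hε : 0 < ε) :
    ∃ k : T, star k = k ∧ ‖k * (a * a * a) * k - a‖ ≤ ε := by
  have hsa : IsSelfAdjoint a := ha.isSelfAdjoint
  set k : ℝ → ℝ := fun t => t / (t ^ 2 + ε ^ 2) with hk
  have hkc : Continuous k := by
    refine continuous_id.div (by fun_prop) fun t => by positivity
  have hk0 : k 0 = 0 := by simp [hk]
  refine ⟨cfcₙ k a, (cfcₙ_predicate k a : IsSelfAdjoint _), ?_⟩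
  have h1 : cfcₙ k a * (a * a * a) * cfcₙ k a - a
      = cfcₙ (fun t => k t * (t * t * t) * k t - t) a := by
    rw [cfcₙ_sub (fun t => k t * (t * t * t) * k t) (fun t => t) a (by fun_prop) (by simp [hk0])
      (by fun_prop) rfl,
      cfcₙ_mul (fun t => k t * (t * t * t)) k a (by fun_prop) (by simp [hk0]) (by fun_prop) hk0,
      cfcₙ_mul k (fun t => t * t * t) a (by fun_prop) hk0 (by fun_prop) (by simp),
      cfcₙ_mul (fun t => t * t) (fun t => t) a (by fun_prop) (by simp) (by fun_prop) rfl,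
      cfcₙ_mul (fun t => t) (fun t => t) a (by fun_prop) rfl (by fun_prop) rfl,
      cfcₙ_id' ℝ a]
  rw [h1]
  refine norm_cfcₙ_le fun t ht => ?_
  have ht0 := quasispectrum_nonneg' ha ht
  have hD : 0 < t ^ 2 + ε ^ 2 := by positivity
  have h2 : k t * (t * t * t) * k t - t
      = - (t * ε ^ 2 * (2 * t ^ 2 + ε ^ 2) / (t ^ 2 + ε ^ 2) ^ 2) := by
    simp only [hk]; field_simp; ring
  rw [h2, norm_neg, Real.norm_of_nonneg (by positivity), div_le_iff₀ (by positivity)]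
  have h3 : 0 ≤ (t - ε) ^ 2 := sq_nonneg _
  have h4 : t * ε * (2 * t ^ 2 + ε ^ 2) ≤ (t ^ 2 + ε ^ 2) ^ 2 := by
    nlinarith [mul_nonneg h3 (sq_nonneg t), mul_nonneg h3 (sq_nonneg ε), sq_nonneg (t*ε),
      mul_nonneg ht0 hε.le, sq_nonneg (t^2), sq_nonneg (ε^2)]
  nlinarith

theorem CuntzBelow.exists_norm_cube_le {a b : T} (h : CuntzBelow a b) (hb : 0 ≤ b) {ε : ℝ}
    (hε : 0 < ε) : ∃ r : T, ‖r * (b * b * b) * star r - a‖ ≤ ε := by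
  obtain ⟨r, hr⟩ := h.exists_norm_le (half_pos hε)
  have hδ : 0 < ε / 2 / (‖r‖ * ‖r‖ + 1) := by positivity
  obtain ⟨k, hk, hkε⟩ := exists_approx_mul_self hb hδ
  refine ⟨r * k, ?_⟩
  have h1 : r * k * (b * b * b) * star (r * k) - a
      = r * (k * (b * b * b) * k - b) * star r + (r * b * star r - a) := by
    rw [star_mul, hk]; noncomm_ring
  rw [h1]
  have h2 : ‖r * (k * (b * b * b) * k - b) * star r‖ ≤ ε / 2 := by
    calc _ ≤ ‖r‖ * ‖k * (b * b * b) * k - b‖ * ‖star r‖ :=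
          (norm_mul_le _ _).trans (by gcongr; exact norm_mul_le _ _)
      _ ≤ ‖r‖ * (ε / 2 / (‖r‖ * ‖r‖ + 1)) * ‖r‖ := by rw [norm_star]; gcongr
      _ = ε / 2 * (‖r‖ * ‖r‖ / (‖r‖ * ‖r‖ + 1)) := by ring
      _ ≤ ε / 2 * 1 := by
          gcongr
          rw [div_le_one (by positivity)]; linarith
      _ = ε / 2 := mul_one _
  linarith [norm_add_le (r * (k * (b * b * b) * k - b) * star r) (r * b * star r - a)]

theorem norm_mul_sub_self_sq_le {b c e : T} {M : ℝ} (hM : 0 ≤ M) (hc : star c * c ≤ M • b)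
    (he : star e = e) : ‖c * e - c‖ ^ 2 ≤ M * ‖b - e * b - b * e + e * b * e‖ := by
  have h0 : star (c * e - c) * (c * e - c)
      = star c * c - e * (star c * c) - (star c * c) * e + e * (star c * c) * e := by
    simp only [star_sub, star_mul, he]; noncomm_ring
  have hconj : ∀ x : T, ((x - e * x - x * e + e * x * e : T) : Unitization ℂ T)
      = star (1 - (e : Unitization ℂ T)) * x * (1 - (e : Unitization ℂ T)) := by
    intro x
    have : star (e : Unitization ℂ T) = e := by rw [← Unitization.inr_star, he]
    rw [star_sub, star_one, this]
    push_cast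
    noncomm_ring
  have h1 : star (c * e - c) * (c * e - c) ≤ M • (b - e * b - b * e + e * b * e) := by
    have h2 : M • (b - e * b - b * e + e * b * e)
        = (M • b) - e * (M • b) - (M • b) * e + e * (M • b) * e := by
      simp only [smul_add, smul_sub, mul_smul_comm, smul_mul_assoc]
    rw [h0, h2, ← Unitization.inr_le_iff _ _ (by
      rw [← h0]; exact IsSelfAdjoint.star_mul_self _) (by
      have hbs : star (M • b) = M • b := by
        have := (star_mul_self_nonneg c).trans hc
        exact this.isSelfAdjoint
      rw [isSelfAdjoint_iff]
      simp only [star_add, star_sub, star_mul, he, hbs]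
      noncomm_ring), hconj, hconj]
    refine star_left_conjugate_le_conjugate ?_ _
    exact (Unitization.inr_le_iff _ _ (IsSelfAdjoint.star_mul_self _) 
      ((star_mul_self_nonneg c).trans hc).isSelfAdjoint).2 hc
  have h3 := CStarAlgebra.norm_le_norm_of_nonneg_of_le (star_mul_self_nonneg _) h1
  rw [CStarRing.norm_star_mul_self, norm_smul, Real.norm_of_nonneg hM] at h3
  rw [sq]; exact h3

theorem cuntzBelow_mul_star_of_star_mul_le {b c : T} {M : ℝ} (hb : 0 ≤ b) (hM : 0 ≤ M)
    (hc : star c * c ≤ M • b) : CuntzBelow (c * star c) b := by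
  refine cuntzBelow_of_forall_norm_le fun ε hε => ?_
  have hsa : IsSelfAdjoint b := hb.isSelfAdjoint
  obtain ⟨η, hη, hη2⟩ : ∃ η : ℝ, 0 < η ∧ η * ‖c‖ ≤ ε := by
    refine ⟨ε / (‖c‖ + 1), by positivity, ?_⟩
    rw [div_mul_eq_mul_div, div_le_iff₀ (by positivity)]
    nlinarith [norm_nonneg c]
  obtain ⟨δ, hδ, hδ2⟩ : ∃ δ : ℝ, 0 < δ ∧ M * (2 * δ) ≤ η ^ 2 := by
    refine ⟨η ^ 2 / (2 * (M + 1)), by positivity, ?_⟩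
    rw [show M * (2 * (η ^ 2 / (2 * (M + 1)))) = η ^ 2 * (M / (M + 1)) by field_simp]
    refine mul_le_of_le_one_right (by positivity) ?_
    rw [div_le_one (by positivity)]; linarith
  set k : ℝ → ℝ := fun t => √|t| / (|t| + δ) with hk
  have hkc : Continuous k := by
    refine Continuous.div (by fun_prop) (by fun_prop) fun t => by positivity
  have hk0 : k 0 = 0 := by simp [hk]
  set f : ℝ → ℝ := fun t => k t * t * k t with hf
  have hf0 : f 0 = 0 := by simp [hf]
  have hfc : Continuous f := by fun_prop
  have he : cfcₙ k b * b * cfcₙ k b = cfcₙ f b := by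
    rw [hf, cfcₙ_mul (fun t => k t * t) k b (by fun_prop) (by simp) (by fun_prop) hk0,
      cfcₙ_mul k (fun t => t) b (by fun_prop) hk0 (by fun_prop) rfl, cfcₙ_id' ℝ b]
  have hes : star (cfcₙ f b) = cfcₙ f b := (cfcₙ_predicate f b : IsSelfAdjoint _)
  have hks : star (cfcₙ k b) = cfcₙ k b := (cfcₙ_predicate k b : IsSelfAdjoint _)
  have hn : ‖b - cfcₙ f b * b - b * cfcₙ f b + cfcₙ f b * b * cfcₙ f b‖ ≤ 2 * δ := by
    have h1 : b - cfcₙ f b * b - b * cfcₙ f b + cfcₙ f b * b * cfcₙ f b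
        = cfcₙ (fun t => t - f t * t - t * f t + f t * t * f t) b := by
      rw [cfcₙ_add (fun t => t - f t * t - t * f t) (fun t => f t * t * f t) b
        (by fun_prop) (by simp) (by fun_prop) (by simp),
        cfcₙ_sub (fun t => t - f t * t) (fun t => t * f t) b
        (by fun_prop) (by simp) (by fun_prop) (by simp),
        cfcₙ_sub (fun t => t) (fun t => f t * t) b (by fun_prop) rfl (by fun_prop) (by simp),
        cfcₙ_mul (fun t => f t * t) f b (by fun_prop) (by simp) (by fun_prop) hf0,
        cfcₙ_mul f (fun t => t) b (by fun_prop) hf0 (by fun_prop) rfl,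
        cfcₙ_mul (fun t => t) f b (by fun_prop) rfl (by fun_prop) hf0, cfcₙ_id' ℝ b]
    rw [h1]
    refine norm_cfcₙ_le fun t ht => ?_
    have ht0 := quasispectrum_nonneg' hb ht
    have hft : f t = t ^ 2 / (t + δ) ^ 2 := by
      simp only [hf, hk, abs_of_nonneg ht0]
      have := Real.mul_self_sqrt ht0
      field_simp
      rw [Real.sq_sqrt ht0, sq]
    have h2 : 1 - f t = δ * (2 * t + δ) / (t + δ) ^ 2 := by
      rw [hft]; field_simp; ring
    have h3 : 0 ≤ 1 - f t := by rw [h2]; positivity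
    have h4 : 1 - f t ≤ 1 := by rw [hft]; have : 0 ≤ t ^ 2 / (t + δ) ^ 2 := by positivity
                                linarith
    have h5 : t * (1 - f t) ≤ 2 * δ := by
      rw [h2, ← mul_div_assoc, div_le_iff₀ (by positivity)]
      nlinarith [mul_nonneg ht0 hδ.le, mul_nonneg ht0 ht0, mul_nonneg hδ.le (mul_nonneg ht0 hδ.le),
        mul_nonneg hδ.le (mul_nonneg hδ.le hδ.le)]
    have h6 : t - f t * t - t * f t + f t * t * f t = t * (1 - f t) * (1 - f t) := by ring
    rw [h6, Real.norm_of_nonneg (by positivity)]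
    exact (mul_le_of_le_one_right (by positivity) h4).trans h5
  have h7 := norm_mul_sub_self_sq_le hM hc hes
  have h8 : ‖c * cfcₙ f b - c‖ ≤ η := by
    refine le_of_sq_le_sq ?_ hη.le
    exact h7.trans ((mul_le_mul_of_nonneg_left hn hM).trans hδ2)
  refine ⟨c * cfcₙ k b, ?_⟩
  have h9 : c * cfcₙ k b * b * star (c * cfcₙ k b) - c * star c
      = (c * cfcₙ f b - c) * star c := by
    rw [← he, star_mul, hks]; noncomm_ring
  rw [h9]
  calc _ ≤ ‖c * cfcₙ f b - c‖ * ‖star c‖ := norm_mul_le _ _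
    _ ≤ η * ‖c‖ := by rw [norm_star]; gcongr
    _ ≤ ε := hη2

theorem cuntzBelow_mul_star_self (c : T) : CuntzBelow (c * star c) (star c * c) :=
  cuntzBelow_mul_star_of_star_mul_le (star_mul_self_nonneg c) zero_le_one (one_smul ℝ _).symm.le

theorem cuntzBelow_of_le_smul {a b : T} {M : ℝ} (ha : 0 ≤ a) (hb : 0 ≤ b) (hM : 0 ≤ M)
    (h : a ≤ M • b) : CuntzBelow a b := by
  have h1 : star (CFC.sqrt a) = CFC.sqrt a := (CFC.sqrt_nonneg a).isSelfAdjoint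
  have h2 : CFC.sqrt a * CFC.sqrt a = a := CFC.sqrt_mul_sqrt_self a ha
  have := cuntzBelow_mul_star_of_star_mul_le (c := CFC.sqrt a) hb hM (by rwa [h1, h2])
  rwa [h1, h2] at this

theorem cuntzBelow_of_le {a b : T} (ha : 0 ≤ a) (h : a ≤ b) : CuntzBelow a b :=
  cuntzBelow_of_le_smul ha (ha.trans h) zero_le_one (by rwa [one_smul])

/-- The cut-down `(a - ε)₊`. -/
noncomputable def cutDown (a : T) (ε : ℝ) : T := cfcₙ (fun t : ℝ => max (t - ε) 0) a

theorem cutDown_nonneg (a : T) (ε : ℝ) : 0 ≤ cutDown a ε :=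
  cfcₙ_nonneg fun _ _ => le_max_right _ _

theorem exists_cutDown_le_conj {a b : T} {ε : ℝ} (ha : 0 ≤ a) (hb : 0 ≤ b) (hε : 0 < ε)
    (h : ‖a - b‖ ≤ ε) : ∃ r : T, cutDown a (2 * ε) ≤ r * b * star r := by
  have hsa : IsSelfAdjoint a := ha.isSelfAdjoint
  set k : ℝ → ℝ := fun t => √(max (t - 2 * ε) 0 / max (t - ε) ε) with hk
  have hkc : Continuous k := by
    refine Real.continuous_sqrt.comp (Continuous.div (by fun_prop) (by fun_prop) fun t => ?_)
    exact (lt_max_of_lt_right hε).ne'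
  have hk0 : k 0 = 0 := by simp [hk, hε.le]
  have hks : star (cfcₙ k a) = cfcₙ k a := (cfcₙ_predicate k a : IsSelfAdjoint _)
  have h1 : cfcₙ k a * a * cfcₙ k a - ε • (cfcₙ k a * cfcₙ k a) = cutDown a (2 * ε) := by
    have : cfcₙ k a * a * cfcₙ k a - ε • (cfcₙ k a * cfcₙ k a)
        = cfcₙ (fun t => k t * t * k t - ε • (k t * k t)) a := by
      rw [cfcₙ_sub (fun t => k t * t * k t) (fun t => ε • (k t * k t)) a (by fun_prop) (by simp)
        (by fun_prop) (by simp [hk0]), cfcₙ_smul ε (fun t => k t * k t) a (by fun_prop)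
        (by simp [hk0]), cfcₙ_mul (fun t => k t * t) k a (by fun_prop) (by simp) (by fun_prop) hk0,
        cfcₙ_mul k (fun t => t) a (by fun_prop) hk0 (by fun_prop) rfl,
        cfcₙ_mul k k a (by fun_prop) hk0 (by fun_prop) hk0, cfcₙ_id' ℝ a]
    rw [this, cutDown]
    refine cfcₙ_congr fun t _ => ?_
    have hkk : k t * k t = max (t - 2 * ε) 0 / max (t - ε) ε :=
      Real.mul_self_sqrt (div_nonneg (le_max_right _ _) (hε.le.trans (le_max_right _ _)))
    have : k t * t * k t - ε • (k t * k t) = (k t * k t) * (t - ε) := by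
      rw [smul_eq_mul]; ring
    rw [this, hkk]
    rcases le_total t (2 * ε) with ht | ht
    · rw [max_eq_right (by linarith)]; simp
    · rw [max_eq_left (by linarith : ε ≤ t - ε), div_mul_cancel₀]
      linarith
  refine ⟨cfcₙ k a, ?_⟩
  rw [hks, ← h1, sub_le_iff_le_add]
  set x := cfcₙ k a
  have hxs : star (x : Unitization ℂ T) = x := by rw [← Unitization.inr_star, hks]
  have h2 : ((a - b : T) : Unitization ℂ T) ≤ algebraMap ℝ (Unitization ℂ T) ε := by
    have hs : IsSelfAdjoint ((a - b : T) : Unitization ℂ T) :=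
      (Unitization.isSelfAdjoint_inr).2 (hsa.sub hb.isSelfAdjoint)
    refine hs.le_algebraMap_norm_self.trans ?_
    rw [Unitization.norm_inr]
    exact algebraMap_mono _ h
  have h3 := star_left_conjugate_le_conjugate h2 (x : Unitization ℂ T)
  rw [hxs, Algebra.algebraMap_eq_smul_one, mul_smul_comm, smul_mul_assoc, mul_one] at h3
  rw [add_comm, ← sub_le_iff_le_add]
  rw [← Unitization.inr_le_iff _ _ ?_ ?_]
  · refine le_trans (le_of_eq ?_) (h3.trans (le_of_eq ?_))
    · push_cast; noncomm_ring
    · rw [Unitization.inr_smul, Unitization.inr_mul]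
  · rw [isSelfAdjoint_iff]
    simp only [star_sub, star_mul, hks, hsa.star_eq, hb.isSelfAdjoint.star_eq]
    noncomm_ring
  · rw [isSelfAdjoint_iff]; simp [hks]

theorem norm_sub_cutDown_le {a : T} (ha : 0 ≤ a) {ε : ℝ} (hε : 0 ≤ ε) :
    ‖a - cutDown a ε‖ ≤ ε := by
  have hsa : IsSelfAdjoint a := ha.isSelfAdjoint
  have h1 : a - cutDown a ε = cfcₙ (fun t : ℝ => t - max (t - ε) 0) a := by
    rw [cfcₙ_sub (fun t : ℝ => t) (fun t => max (t - ε) 0) a (by fun_prop) rfl (by fun_prop)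
      (by simp [hε]), cfcₙ_id' ℝ a, cutDown]
  rw [h1]
  refine norm_cfcₙ_le fun t ht => ?_
  have ht0 := quasispectrum_nonneg' ha ht
  rw [Real.norm_eq_abs, abs_le]
  rcases le_total t ε with h | h
  · rw [max_eq_right (by linarith)]; constructor <;> linarith
  · rw [max_eq_left (by linarith)]; constructor <;> linarith

end CuntzComparison

namespace CuSemigroup

variable {S : Type*} [CuSemigroup S]

theorem _root_.WayBelow.le {x y : S} (h : WayBelow x y) : x ≤ y := by
  obtain ⟨n, hn⟩ := h (fun _ => y) monotone_const y (by simp) le_rfl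
  exact hn

theorem _root_.WayBelow.trans_le {x y z : S} (h : WayBelow x y) (h' : y ≤ z) : WayBelow x z :=
  fun f hf s hs hz => h f hf s hs (h'.trans hz)

theorem wayBelow_of_le {x y z : S} (h : x ≤ y) (h' : WayBelow y z) : WayBelow x z :=
  fun f hf s hs hz => (h' f hf s hs hz).imp fun _ hn => h.trans hn

theorem exists_wayBelow_between {x y : S} (h : WayBelow x y) :
    ∃ z, WayBelow x z ∧ WayBelow z y := by
  obtain ⟨f, hf, hf', hs⟩ := exists_waybelow_seq y
  obtain ⟨n, hn⟩ := h f hf y hs le_rfl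
  exact ⟨f (n + 1), wayBelow_of_le hn (hf' n), (hf' (n + 1)).trans_le (hs.1 ⟨n + 2, rfl⟩)⟩

theorem add_le_add {a b c d : S} (h : a ≤ b) (h' : c ≤ d) : a + c ≤ b + d := by
  refine (add_le_add' _ _ h' a).trans ?_
  rw [add_comm a, add_comm b]
  exact add_le_add' _ _ h d

theorem le_add_left (a b : S) : a ≤ b + a := by
  simpa using add_le_add (zero_le' b) (le_refl a)

theorem le_add_right (a b : S) : a ≤ a + b := by
  rw [add_comm]; exact le_add_left a b

theorem nsmul_le_nsmul (n : ℕ) {a b : S} (h : a ≤ b) : n • a ≤ n • b := by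
  induction n with
  | zero => simp
  | succ n ih => rw [succ_nsmul, succ_nsmul]; exact add_le_add ih h

theorem nsmul_mono (a : S) : Monotone fun n : ℕ => n • a :=
  monotone_nat_of_le_succ fun n => by
    rw [succ_nsmul]; exact le_add_right _ _

/-- The elements all of whose way-below elements lie below a member of `W`. -/
def IsBelow (W : AddSubmonoid S) (x : S) : Prop := ∀ x', WayBelow x' x → ∃ w ∈ W, x' ≤ w

theorem IsBelow.mono {W : AddSubmonoid S} {x y : S} (hy : IsBelow W y) (h : x ≤ y) :
    IsBelow W x := fun x' hx' => hy x' (hx'.trans_le h)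

theorem isBelow_of_mem {W : AddSubmonoid S} {x : S} (h : x ∈ W) : IsBelow W x :=
  fun _ hx' => ⟨x, h, hx'.le⟩

end CuSemigroup

namespace IsCuntzSemigroupOf

open CuSemigroup

variable {A : Type*} [NonUnitalCStarAlgebra A] {S : Type*} [CuSemigroup S]
  (hS : IsCuntzSemigroupOf A S)

noncomputable instance stabPartialOrder : PartialOrder hS.stab := CStarAlgebra.spectralOrder _

instance stabStarOrderedRing : StarOrderedRing hS.stab := CStarAlgebra.spectralOrderedRing _

variable {hS}

theorem exists_nonneg_cls_eq (x : S) : ∃ a : hS.stab, 0 ≤ a ∧ hS.cls a = x := by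
  obtain ⟨a, ha, h⟩ := hS.cls_surj x
  exact ⟨a, cstarNonneg_iff.1 ha, h⟩

theorem cls_le_cls_iff {a b : hS.stab} (ha : 0 ≤ a) (hb : 0 ≤ b) :
    hS.cls a ≤ hS.cls b ↔ CuntzBelow a b :=
  hS.cls_le_iff a b (cstarNonneg_iff.2 ha) (cstarNonneg_iff.2 hb)

theorem cls_conj_le (r : hS.stab) {a : hS.stab} (ha : 0 ≤ a) :
    hS.cls (r * a * star r) ≤ hS.cls a :=
  (cls_le_cls_iff (star_right_conjugate_nonneg ha r) ha).2 (cuntzBelow_conj r a)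

theorem cls_le_of_le_smul {a b : hS.stab} {M : ℝ} (ha : 0 ≤ a) (hb : 0 ≤ b) (hM : 0 ≤ M)
    (h : a ≤ M • b) : hS.cls a ≤ hS.cls b :=
  (cls_le_cls_iff ha hb).2 (cuntzBelow_of_le_smul ha hb hM h)

theorem cls_mono {a b : hS.stab} (ha : 0 ≤ a) (h : a ≤ b) : hS.cls a ≤ hS.cls b :=
  (cls_le_cls_iff ha (ha.trans h)).2 (cuntzBelow_of_le ha h)

theorem cls_mul_star_self_le (c : hS.stab) : hS.cls (c * star c) ≤ hS.cls (star c * c) :=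
  (cls_le_cls_iff (mul_star_self_nonneg c) (star_mul_self_nonneg c)).2 (cuntzBelow_mul_star_self c)

theorem cls_mul_star_self (c : hS.stab) : hS.cls (c * star c) = hS.cls (star c * c) :=
  (cls_mul_star_self_le c).antisymm (by simpa using cls_mul_star_self_le (star c))

theorem cls_add_of_mul_eq_zero {a b : hS.stab} (ha : 0 ≤ a) (hb : 0 ≤ b) (h : a * b = 0) :
    hS.cls (a + b) = hS.cls a + hS.cls b :=
  hS.cls_add_orth a b (cstarNonneg_iff.2 ha) (cstarNonneg_iff.2 hb) h

theorem exists_orthogonal (x y : S) : ∃ a b : hS.stab, 0 ≤ a ∧ 0 ≤ b ∧ a * b = 0 ∧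
    hS.cls a = x ∧ hS.cls b = y := by
  obtain ⟨a, ha, rfl⟩ := hS.cls_surj x
  obtain ⟨b, hb, rfl⟩ := hS.cls_surj y
  obtain ⟨a', b', ha', hb', h, h1, h2⟩ := hS.exists_orth a b ha hb
  exact ⟨a', b', cstarNonneg_iff.1 ha', cstarNonneg_iff.1 hb', h, h1, h2⟩

theorem cls_add_le {a b : hS.stab} (ha : 0 ≤ a) (hb : 0 ≤ b) :
    hS.cls (a + b) ≤ hS.cls a + hS.cls b := by
  obtain ⟨a', b', ha', hb', h0, h1, h2⟩ := exists_orthogonal (hS := hS) (hS.cls a) (hS.cls b)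
  have h0' : b' * a' = 0 := by
    have := congrArg star h0
    rwa [star_mul, ha'.isSelfAdjoint.star_eq, hb'.isSelfAdjoint.star_eq, star_zero] at this
  rw [← h1, ← h2, ← cls_add_of_mul_eq_zero ha' hb' h0,
    cls_le_cls_iff (add_nonneg ha hb) (add_nonneg ha' hb')]
  refine cuntzBelow_of_forall_norm_le fun ε hε => ?_
  obtain ⟨r, hr⟩ := ((cls_le_cls_iff ha ha').1 h1.ge).exists_norm_cube_le ha' (half_pos hε)
  obtain ⟨s, hs⟩ := ((cls_le_cls_iff hb hb').1 h2.ge).exists_norm_cube_le hb' (half_pos hε)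
  refine ⟨r * a' + s * b', ?_⟩
  have h3 : (r * a' + s * b') * (a' + b') * star (r * a' + s * b') - (a + b)
      = (r * (a' * a' * a') * star r - a) + (s * (b' * b' * b') * star s - b) := by
    rw [star_add, star_mul, star_mul, ha'.isSelfAdjoint.star_eq, hb'.isSelfAdjoint.star_eq]
    have e1 : (r * a' + s * b') * (a' + b') = r * (a' * a') + s * (b' * b') := by
      simp only [add_mul, mul_add, mul_assoc, h0, h0', mul_zero, add_zero, zero_add]
    have e2 : a' * a' * (b' * star s) = 0 := by
      rw [mul_assoc, ← mul_assoc a' b', h0, zero_mul, mul_zero]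
    have e3 : b' * b' * (a' * star r) = 0 := by
      rw [mul_assoc, ← mul_assoc b' a', h0', zero_mul, mul_zero]
    rw [e1, add_mul, mul_add, mul_add, mul_assoc r _ (b' * star s), e2,
      mul_assoc s _ (a' * star r), e3]
    noncomm_ring
  rw [h3]
  exact (norm_add_le _ _).trans (by linarith)

theorem cls_cutDown_le_of_norm_sub_le {a b : hS.stab} {ε : ℝ} (ha : 0 ≤ a) (hb : 0 ≤ b)
    (hε : 0 < ε) (h : ‖a - b‖ ≤ ε) : hS.cls (cutDown a (2 * ε)) ≤ hS.cls b := by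
  obtain ⟨r, hr⟩ := exists_cutDown_le_conj ha hb hε h
  exact (cls_mono (cutDown_nonneg _ _) hr).trans (cls_conj_le r hb)

theorem wayBelow_cls_iff {x : S} {a : hS.stab} (ha : 0 ≤ a) :
    WayBelow x (hS.cls a) ↔ ∃ ε : ℝ, 0 < ε ∧ x ≤ hS.cls (cutDown a ε) :=
  hS.waybelow_iff x a (cstarNonneg_iff.2 ha)

theorem cls_cutDown_wayBelow {a : hS.stab} (ha : 0 ≤ a) {ε : ℝ} (hε : 0 < ε) :
    WayBelow (hS.cls (cutDown a ε)) (hS.cls a) :=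
  (wayBelow_cls_iff ha).2 ⟨ε, hε, le_rfl⟩

theorem exists_wayBelow_add_of_wayBelow_add (hS : IsCuntzSemigroupOf A S) {x' x y : S}
    (h : WayBelow x' (x + y)) :
    ∃ x₁ y₁, WayBelow x₁ x ∧ WayBelow y₁ y ∧ x' ≤ x₁ + y₁ := by
  obtain ⟨a, b, ha, hb, h0, rfl, rfl⟩ := exists_orthogonal (hS := hS) x y
  rw [← cls_add_of_mul_eq_zero ha hb h0, wayBelow_cls_iff (add_nonneg ha hb)] at h
  obtain ⟨ε, hε, hx⟩ := h
  have hη : 0 < ε / 4 := by positivity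
  refine ⟨_, _, cls_cutDown_wayBelow ha hη, cls_cutDown_wayBelow hb hη, hx.trans ?_⟩
  refine le_trans ?_ (cls_add_le (cutDown_nonneg _ _) (cutDown_nonneg _ _))
  have h1 : ‖a + b - (cutDown a (ε / 4) + cutDown b (ε / 4))‖ ≤ ε / 2 := by
    rw [add_sub_add_comm]
    refine (norm_add_le _ _).trans ?_
    linarith [norm_sub_cutDown_le ha hη.le, norm_sub_cutDown_le hb hη.le]
  have := cls_cutDown_le_of_norm_sub_le (add_nonneg ha hb)
    (add_nonneg (cutDown_nonneg _ _) (cutDown_nonneg _ _)) (half_pos hε) h1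
  rwa [mul_div_cancel₀ _ two_ne_zero] at this

theorem isBelow_add (hS : IsCuntzSemigroupOf A S) {W : AddSubmonoid S} {x y : S}
    (hx : IsBelow W x) (hy : IsBelow W y) :
    IsBelow W (x + y) := by
  intro z hz
  obtain ⟨x₁, y₁, h1, h2, h3⟩ := exists_wayBelow_add_of_wayBelow_add hS hz
  obtain ⟨v, hv, hv'⟩ := hx _ h1
  obtain ⟨w, hw, hw'⟩ := hy _ h2
  exact ⟨v + w, W.add_mem hv hw, h3.trans (add_le_add hv' hw')⟩

variable (hS)

/-- Membership predicate of the ideal of the stabilization attached to `W`. -/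
def MemIdeal (W : AddSubmonoid S) (c : hS.stab) : Prop := IsBelow W (hS.cls (star c * c))

variable {hS}

theorem MemIdeal.star {W : AddSubmonoid S} {c : hS.stab} (h : hS.MemIdeal W c) :
    hS.MemIdeal W (star c) := by
  rw [MemIdeal, star_star, cls_mul_star_self]; exact h

theorem MemIdeal.mul_left {W : AddSubmonoid S} {c : hS.stab} (h : hS.MemIdeal W c) (b : hS.stab) :
    hS.MemIdeal W (b * c) := by
  refine IsBelow.mono h (cls_le_of_le_smul (M := ‖Star.star b * b‖) (star_mul_self_nonneg _)
    (star_mul_self_nonneg _) (norm_nonneg _) ?_)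
  have := CStarAlgebra.star_left_conjugate_le_norm_smul (a := c) (b := Star.star b * b)
    (IsSelfAdjoint.star_mul_self b)
  refine le_trans (le_of_eq ?_) this
  rw [star_mul]; noncomm_ring

theorem MemIdeal.add {W : AddSubmonoid S} {c d : hS.stab} (hc : hS.MemIdeal W c)
    (hd : hS.MemIdeal W d) : hS.MemIdeal W (c + d) := by
  refine IsBelow.mono (isBelow_add hS hc hd) ?_
  refine le_trans (cls_le_of_le_smul (M := 2) (star_mul_self_nonneg _)
    (add_nonneg (star_mul_self_nonneg c) (star_mul_self_nonneg d)) zero_le_two ?_)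
    (cls_add_le (star_mul_self_nonneg _) (star_mul_self_nonneg _))
  rw [← sub_nonneg]
  have : (2 : ℝ) • (Star.star c * c + Star.star d * d) - Star.star (c + d) * (c + d)
      = Star.star (c - d) * (c - d) := by
    rw [two_smul, star_add, star_sub]; noncomm_ring
  rw [this]
  exact star_mul_self_nonneg _

theorem MemIdeal.smul {W : AddSubmonoid S} {c : hS.stab} (h : hS.MemIdeal W c) (z : ℂ) :
    hS.MemIdeal W (z • c) := by
  refine IsBelow.mono h (cls_le_of_le_smul (M := ‖z‖ ^ 2) (star_mul_self_nonneg _)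
    (star_mul_self_nonneg _) (by positivity) (le_of_eq ?_))
  rw [star_smul, smul_mul_smul_comm, RCLike.star_def, RCLike.conj_mul, ← Complex.coe_smul]
  norm_cast

theorem isClosed_memIdeal (W : AddSubmonoid S) : IsClosed {c : hS.stab | hS.MemIdeal W c} := by
  refine isClosed_of_closure_subset fun c hc => ?_
  intro x hx
  obtain ⟨y, hxy, hy⟩ := exists_wayBelow_between hx
  obtain ⟨ε, hε, hyε⟩ := (wayBelow_cls_iff (star_mul_self_nonneg c)).1 hy
  have hcont : Continuous fun d : hS.stab => ‖Star.star c * c - Star.star d * d‖ := by fun_prop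
  obtain ⟨d, hd, hdW⟩ := mem_closure_iff.1 hc {d | ‖Star.star c * c - Star.star d * d‖ < ε / 2}
    (isOpen_lt hcont continuous_const) (by simpa using hε)
  refine hdW x (hxy.trans_le (hyε.trans ?_))
  have := cls_cutDown_le_of_norm_sub_le (star_mul_self_nonneg c) (star_mul_self_nonneg d)
    (half_pos hε) (le_of_lt hd)
  rwa [mul_div_cancel₀ _ two_ne_zero] at this

variable (hS)

/-- The closed ideal of the stabilization attached to a submonoid of the Cuntz semigroup. -/
def cuIdeal (W : AddSubmonoid S) : ClosedTwoSidedIdealC hS.stab where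
  carrier :=
    { carrier := {c | hS.MemIdeal W c}
      add_mem' := MemIdeal.add
      zero_mem' := by
        intro x hx
        refine ⟨0, W.zero_mem, ?_⟩
        simpa [hS.cls_zero] using hx.le
      mul_mem' := fun {a _} _ hb => hb.mul_left a
      smul_mem' := fun z _ h => h.smul z
      star_mem' := MemIdeal.star }
  isClosed := isClosed_memIdeal W
  mul_mem_left := fun a _ h => MemIdeal.mul_left h a
  mul_mem_right := fun a x h => by
    have := (MemIdeal.mul_left (MemIdeal.star h) (star a)).star
    rwa [star_mul, star_star, star_star] at this

variable {hS}

theorem mem_cuIdeal {W : AddSubmonoid S} {c : hS.stab} :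
    c ∈ (hS.cuIdeal W).carrier ↔ IsBelow W (hS.cls (star c * c)) := Iff.rfl

theorem mem_cuIdeal_of_nonneg {W : AddSubmonoid S} {a : hS.stab} (ha : 0 ≤ a) :
    a ∈ (hS.cuIdeal W).carrier ↔ IsBelow W (hS.cls a) := by
  have h1 : star (CFC.sqrt a) = CFC.sqrt a := (CFC.sqrt_nonneg a).isSelfAdjoint
  have h2 : star (CFC.sqrt a) * CFC.sqrt a = a := by rw [h1, CFC.sqrt_mul_sqrt_self a ha]
  constructor
  · intro h
    rw [← h2] at h
    have := (hS.cuIdeal W).mem_of_star_mul_self_mem h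
    rwa [mem_cuIdeal, h2] at this
  · intro h
    rw [← CFC.sqrt_mul_sqrt_self a ha]
    refine (hS.cuIdeal W).mul_mem_left _ _ ?_
    rwa [mem_cuIdeal, h2]

end IsCuntzSemigroupOf

theorem mem_of_forall_mul_mem {A : Type*} [NonUnitalCStarAlgebra A] {N : Set A} (hN : IsClosed N)
    (h : ∀ a b, a * b ∈ N) (x : A) : x ∈ N := by
  let _ := CStarAlgebra.spectralOrder A
  have := CStarAlgebra.spectralOrderedRing A
  have hu := (CStarAlgebra.increasingApproximateUnit A).toIsApproximateUnit
  have := hu.neBot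
  exact hN.mem_of_tendsto (hu.tendsto_mul_left x) (Eventually.of_forall fun e => h x e)

namespace ClosedTwoSidedIdealC

/-- The preimage of a closed ideal under a star homomorphism. -/
def comap {A B : Type*} [NonUnitalCStarAlgebra A] [NonUnitalCStarAlgebra B] (f : A →⋆ₙₐ[ℂ] B)
    (L : ClosedTwoSidedIdealC B) : ClosedTwoSidedIdealC A where
  carrier := L.carrier.comap f
  isClosed := L.isClosed.preimage (AddMonoidHomClass.continuous_of_bound f 1 fun a => by
    rw [one_mul]; exact NonUnitalStarAlgHom.norm_apply_le f a)
  mul_mem_left a x hx := by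
    change f (a * x) ∈ L.carrier
    rw [map_mul]; exact L.mul_mem_left _ _ hx
  mul_mem_right a x hx := by
    change f (x * a) ∈ L.carrier
    rw [map_mul]; exact L.mul_mem_right _ _ hx

theorem mem_comap {A B : Type*} [NonUnitalCStarAlgebra A] [NonUnitalCStarAlgebra B]
    {f : A →⋆ₙₐ[ℂ] B} {L : ClosedTwoSidedIdealC B} {a : A} :
    a ∈ (L.comap f).carrier ↔ f a ∈ L.carrier := Iff.rfl

end ClosedTwoSidedIdealC

theorem matPad_single {A : Type*} [NonUnitalCStarAlgebra A] (n : ℕ) (a : A) :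
    matPad (Matrix.single (0 : Fin (n + 1)) 0 a) = Matrix.single 0 0 a := by
  ext i j
  simp only [matPad, Matrix.of_apply, Matrix.single_apply, Fin.ext_iff, Fin.val_zero]
  by_cases hi : (0 : ℕ) = i <;> by_cases hj : (0 : ℕ) = j
  · simp [← hi, ← hj]
  all_goals simp [hi, hj]
  all_goals omega

namespace IsCuntzSemigroupOf

variable {A : Type*} [NonUnitalCStarAlgebra A] {S : Type*} [CuSemigroup S]
  (hS : IsCuntzSemigroupOf A S)

/-- The embedding of the algebra into its stabilization as the `i`-th diagonal corner. -/
def embAt {n : ℕ} (i : Fin n) : A →⋆ₙₐ[ℂ] hS.stab where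
  toFun a := hS.matEmb n (Matrix.single i i a)
  map_smul' z a := by rw [← Matrix.smul_single, map_smul]; rfl
  map_zero' := by rw [Matrix.single_zero, map_zero]
  map_add' a b := by rw [Matrix.single_add, map_add]
  map_mul' a b := by rw [← map_mul, Matrix.single_mul_single_same]
  map_star' a := by rw [← map_star, Matrix.star_eq_conjTranspose, Matrix.conjTranspose_single]

/-- The canonical embedding of the algebra into its stabilization. -/
def emb : A →⋆ₙₐ[ℂ] hS.stab := hS.embAt (0 : Fin 1)

theorem norm_matEmb_single_le {n : ℕ} (i j : Fin n) (a : A) :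
    ‖hS.matEmb n (Matrix.single i j a)‖ ≤ ‖a‖ := by
  refine le_of_sq_le_sq ?_ (norm_nonneg a)
  have h : star (hS.matEmb n (Matrix.single i j a)) * hS.matEmb n (Matrix.single i j a)
      = hS.embAt j (star a * a) := by
    rw [← map_star, ← map_mul, Matrix.star_eq_conjTranspose, Matrix.conjTranspose_single,
      Matrix.single_mul_single_same]
    rfl
  rw [sq, sq, ← CStarRing.norm_star_mul_self, ← CStarRing.norm_star_mul_self, h]
  exact NonUnitalStarAlgHom.norm_apply_le _ _

theorem continuous_matEmb_single {n : ℕ} (i j : Fin n) :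
    Continuous fun a : A => hS.matEmb n (Matrix.single i j a) := by
  refine AddMonoidHomClass.continuous_of_bound
    ((AddMonoidHomClass.toAddMonoidHom (hS.matEmb n)).comp (Matrix.singleAddMonoidHom i j))
    1 fun a => ?_
  rw [one_mul]; exact hS.norm_matEmb_single_le i j a

theorem matEmb_single (n : ℕ) (a : A) : hS.matEmb (n + 1) (Matrix.single 0 0 a) = hS.emb a := by
  induction n with
  | zero => rfl
  | succ n ih => rw [← matPad_single, hS.matEmb_compat, ih]

theorem emb_injective : Function.Injective hS.emb := fun a b h => by
  have := congrFun (congrFun (hS.matEmb_injective 1 h) 0) 0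
  simpa using this

theorem isClosed_range_emb : IsClosed (Set.range hS.emb) :=
  (NonUnitalStarAlgHom.isometry hS.emb hS.emb_injective).isClosedEmbedding.isClosed_range

variable {hS}

theorem induction_matEmb {N : Set hS.stab} (hN : IsClosed N)
    (h : ∀ (n : ℕ) (m : Matrix (Fin (n + 1)) (Fin (n + 1)) A), hS.matEmb (n + 1) m ∈ N)
    (x : hS.stab) : x ∈ N := by
  refine hN.closure_subset_iff.2 ?_ (hS.matEmb_dense x)
  refine Set.iUnion_subset ?_
  rintro n _ ⟨m, rfl⟩
  rw [← hS.matEmb_compat]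
  exact h n _

theorem emb_mul_mul_emb_mem_range (u v : A) (s : hS.stab) :
    hS.emb u * s * hS.emb v ∈ Set.range hS.emb := by
  revert s
  refine induction_matEmb (N := {s | hS.emb u * s * hS.emb v ∈ Set.range hS.emb})
    (hS.isClosed_range_emb.preimage (by fun_prop)) fun n m => ⟨u * m 0 0 * v, ?_⟩
  rw [← hS.matEmb_single n, ← hS.matEmb_single n, ← hS.matEmb_single n, ← map_mul, ← map_mul]
  congr 1
  exact (Matrix.single_mul_mul_single 0 0 0 0 u m v).symm

theorem mem_of_emb_mul_mem (L : ClosedTwoSidedIdealC hS.stab) {d : hS.stab}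
    (h : ∀ (u : A) (s : hS.stab), hS.emb u * s * d ∈ L.carrier) : d ∈ L.carrier := by
  have hN : IsClosed {x : hS.stab | x * d ∈ L.carrier} :=
    L.isClosed.preimage (continuous_mul_const d)
  have key : ∀ x : hS.stab, x * d ∈ L.carrier := by
    refine induction_matEmb hN fun n m => ?_
    change _ * d ∈ L.carrier
    rw [Matrix.matrix_eq_sum_single m]
    simp only [map_sum, Finset.sum_mul]
    refine sum_mem fun i _ => sum_mem fun j _ => ?_
    have hcont : Continuous fun a : A => hS.matEmb (n + 1) (Matrix.single i j a) * d :=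
      (hS.continuous_matEmb_single i j).mul_const d
    refine mem_of_forall_mul_mem
      (N := {a | hS.matEmb (n + 1) (Matrix.single i j a) * d ∈ L.carrier})
      (L.isClosed.preimage hcont) (fun a b => ?_) (m i j)
    refine mem_of_forall_mul_mem
      (N := {a | hS.matEmb (n + 1) (Matrix.single i j (a * b)) * d ∈ L.carrier})
      (L.isClosed.preimage (hcont.comp (continuous_mul_const b))) (fun a a' => ?_) a
    change _ ∈ L.carrier
    have : Matrix.single i j (a * a' * b) = Matrix.single i 0 a *
        (Matrix.single (0 : Fin (n + 1)) 0 a' * Matrix.single 0 j b) := by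
      simp [mul_assoc]
    rw [this, map_mul, map_mul, matEmb_single, mul_assoc]
    exact L.mul_mem_left _ _ (h _ _)
  exact L.mem_of_star_mul_self_mem (key (star d))

theorem mem_of_emb_mul_mul_emb_mem (L : ClosedTwoSidedIdealC hS.stab) {c : hS.stab}
    (h : ∀ (u : A) (s t : hS.stab) (v : A), hS.emb u * s * (c * t * hS.emb v) ∈ L.carrier) :
    c ∈ L.carrier := by
  rw [← star_star c]
  refine star_mem (mem_of_emb_mul_mem L fun v t => ?_)
  have := star_mem (s := L.carrier)
    (mem_of_emb_mul_mem L fun u s => h u s (star t) (star v))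
  rwa [star_mul, star_mul, ← map_star, star_star, star_star, ← mul_assoc] at this

end IsCuntzSemigroupOf

section ClosedRange

variable {A B : Type*} [NonUnitalCStarAlgebra A] [NonUnitalCStarAlgebra B]

theorem NonUnitalStarAlgHom.continuous_of_cstar (π : A →⋆ₙₐ[ℂ] B) : Continuous π :=
  AddMonoidHomClass.continuous_of_bound π 1 fun a => by
    rw [one_mul]; exact NonUnitalStarAlgHom.norm_apply_le π a

theorem exists_lift_norm_le_of_isSelfAdjoint (π : A →⋆ₙₐ[ℂ] B) {a : A} (ha : IsSelfAdjoint a) :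
    ∃ a', π a' = π a ∧ ‖a'‖ ≤ ‖π a‖ := by
  have hπa : IsSelfAdjoint (π a) := ha.map π
  set f : ℝ → ℝ := fun t => max (-‖π a‖) (min ‖π a‖ t) with hf
  have hf0 : f 0 = 0 := by simp [hf]
  refine ⟨cfcₙ f a, ?_, norm_cfcₙ_le fun t _ => ?_⟩
  · rw [π.map_cfcₙ f a (by fun_prop) hf0 π.continuous_of_cstar]
    conv_rhs => rw [← cfcₙ_id' ℝ (π a)]
    refine cfcₙ_congr fun t ht => ?_
    have := NonUnitalIsometricContinuousFunctionalCalculus.norm_quasispectrum_le (π a) ht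
    rw [Real.norm_eq_abs, abs_le] at this
    simp only [hf]
    rw [min_eq_right this.2, max_eq_right this.1]
  · rw [Real.norm_eq_abs, abs_le]
    exact ⟨le_max_left _ _, max_le (by linarith [norm_nonneg (π a)]) (min_le_left _ _)⟩

theorem exists_lift_norm_le (π : A →⋆ₙₐ[ℂ] B) (a : A) :
    ∃ a', π a' = π a ∧ ‖a'‖ ≤ 2 * ‖π a‖ := by
  have key : ∀ h : selfAdjoint A, ‖π (h : A)‖ ≤ ‖π a‖ →
      ∃ a', π a' = π (h : A) ∧ ‖a'‖ ≤ ‖π a‖ := fun h hh => by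
    obtain ⟨a', h1, h2⟩ := exists_lift_norm_le_of_isSelfAdjoint π h.2
    exact ⟨a', h1, h2.trans hh⟩
  have hnorm : ‖(2⁻¹ : ℝ) • (π a + star (π a))‖ ≤ ‖π a‖ := by
    rw [norm_smul, Real.norm_of_nonneg (by norm_num)]
    have := norm_add_le (π a) (star (π a))
    rw [norm_star] at this
    linarith
  have hnorm' : ‖(2⁻¹ : ℝ) • (π a - star (π a))‖ ≤ ‖π a‖ := by
    rw [norm_smul, Real.norm_of_nonneg (by norm_num)]
    have := norm_sub_le (π a) (star (π a))
    rw [norm_star] at this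
    linarith
  obtain ⟨x, hx, hx'⟩ := key (realPart a) (by
    rw [realPart_apply_coe, ← Complex.coe_smul, map_smul, map_add, map_star, Complex.coe_smul]
    exact hnorm)
  obtain ⟨y, hy, hy'⟩ := key (imaginaryPart a) (by
    rw [imaginaryPart_apply_coe, map_smul, ← Complex.coe_smul, map_smul, map_sub, map_star,
      Complex.coe_smul, norm_smul, norm_neg, Complex.norm_I, one_mul]
    exact hnorm')
  refine ⟨x + Complex.I • y, ?_, ?_⟩
  · rw [map_add, map_smul, hx, hy, ← map_smul, ← map_add, realPart_add_I_smul_imaginaryPart]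
  · refine (norm_add_le _ _).trans ?_
    rw [norm_smul, Complex.norm_I, one_mul]
    linarith

theorem isClosed_range_of_cstar (π : A →⋆ₙₐ[ℂ] B) : IsClosed (Set.range π) := by
  let f : NormedAddGroupHom A B :=
    AddMonoidHom.mkNormedAddGroupHom (AddMonoidHomClass.toAddMonoidHom π) 1 fun a => by
      rw [one_mul]; exact NonUnitalStarAlgHom.norm_apply_le π a
  have h : f.SurjectiveOnWith f.range 2 := by
    rintro _ ⟨a, rfl⟩
    exact exists_lift_norm_le π a
  have h' := controlled_closure_of_complete zero_lt_two one_pos h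
  refine isClosed_of_closure_subset fun b hb => ?_
  obtain ⟨a, ha, -⟩ := h' b hb
  exact ⟨a, ha⟩

end ClosedRange

section CompactOperators

variable {H : Type*} [NormedAddCommGroup H] [InnerProductSpace ℂ H]

theorem IsCompactOperator.exists_starProjection_approx {T : H →L[ℂ] H} (hT : IsCompactOperator T)
    {ε : ℝ} (hε : 0 < ε) :
    ∃ (U : Submodule ℂ H) (_ : FiniteDimensional ℂ U), ‖T - U.starProjection * T‖ ≤ ε := by
  have hc := (hT.isCompact_closure_image_closedBall 1).totallyBounded
  obtain ⟨t, ht, hcover⟩ := Metric.totallyBounded_iff.1 hc ε hε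
  have : FiniteDimensional ℂ (Submodule.span ℂ t) := FiniteDimensional.span_of_finite ℂ ht
  refine ⟨Submodule.span ℂ t, this, ?_⟩
  set U := Submodule.span ℂ t
  refine ContinuousLinearMap.opNorm_le_of_unit_norm hε.le fun x hx => ?_
  have hmem : T x ∈ closure (T '' Metric.closedBall 0 1) :=
    subset_closure ⟨x, by simp [hx], rfl⟩
  obtain ⟨y, hy, hyx⟩ := Set.mem_iUnion₂.1 (hcover hmem)
  have hPy : U.starProjection y = y := Submodule.starProjection_eq_self_iff.2
    (Submodule.subset_span hy)
  have h1 : (T - U.starProjection * T) x = Uᗮ.starProjection (T x - y) := by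
    rw [Submodule.starProjection_orthogonal']
    simp [hPy]
  rw [h1]
  calc _ ≤ ‖Uᗮ.starProjection‖ * ‖T x - y‖ := ContinuousLinearMap.le_opNorm _ _
    _ ≤ 1 * ε := by
        gcongr
        · exact Submodule.starProjection_norm_le _
        · rw [← dist_eq_norm]; exact le_of_lt hyx
    _ = ε := one_mul ε

theorem isCompactOperator_rankOne (x y : H) :
    IsCompactOperator (InnerProductSpace.rankOne ℂ x y) := by
  rw [InnerProductSpace.rankOne_def']
  have : IsCompactOperator (innerSL ℂ y) := by
    refine ⟨Metric.closedBall 0 1, isCompact_closedBall 0 1, ?_⟩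
    exact (innerSL ℂ y).continuous.continuousAt.preimage_mem_nhds
      (by simpa using Metric.closedBall_mem_nhds (0 : ℂ) one_pos)
  exact this.clm_comp (ContinuousLinearMap.toSpanSingleton ℂ x)

variable [CompleteSpace H]

theorem IsCompactOperator.mem_of_forall_rankOne_mem {N : AddSubmonoid (H →L[ℂ] H)}
    (hN : IsClosed (N : Set (H →L[ℂ] H))) (h : ∀ x y, InnerProductSpace.rankOne ℂ x y ∈ N)
    {T : H →L[ℂ] H} (hT : IsCompactOperator T) : T ∈ N := by
  refine hN.closure_subset_iff.2 subset_rfl (Metric.mem_closure_iff.2 fun ε hε => ?_)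
  obtain ⟨U, _, hU⟩ := hT.exists_starProjection_approx (half_pos hε)
  refine ⟨U.starProjection * T, ?_, by rw [dist_eq_norm]; linarith⟩
  rw [(stdOrthonormalBasis ℂ U).starProjection_eq_sum_rankOne, Finset.sum_mul]
  refine sum_mem fun i _ => ?_
  rw [ContinuousLinearMap.mul_def, InnerProductSpace.rankOne_comp]
  exact h _ _

theorem IsCompactOperator.star {T : H →L[ℂ] H} (hT : IsCompactOperator T) :
    IsCompactOperator (star T : H →L[ℂ] H) := by
  let N : AddSubmonoid (H →L[ℂ] H) :=
    { carrier := {T | IsCompactOperator (Star.star T : H →L[ℂ] H)}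
      zero_mem' := by
        simpa using (isCompactOperator_zero : IsCompactOperator (0 : H → H))
      add_mem' := fun {a b} ha hb => by
        change IsCompactOperator (Star.star (a + b) : H →L[ℂ] H)
        rw [star_add]
        exact IsCompactOperator.add ha hb }
  refine IsCompactOperator.mem_of_forall_rankOne_mem (N := N) ?_ (fun x y => ?_) hT
  · exact isClosed_setOfPred_isCompactOperator.preimage continuous_star
  · change IsCompactOperator (Star.star (InnerProductSpace.rankOne ℂ x y) : H →L[ℂ] H)
    rw [ContinuousLinearMap.star_eq_adjoint, InnerProductSpace.adjoint_rankOne]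
    exact isCompactOperator_rankOne y x

end CompactOperators

namespace IsIrreducibleRep

variable {A : Type*} [NonUnitalCStarAlgebra A] {H : Type*} [NormedAddCommGroup H]
  [InnerProductSpace ℂ H] [CompleteSpace H] {π : A →⋆ₙₐ[ℂ] (H →L[ℂ] H)}

theorem denseRange (hπ : IsIrreducibleRep π) {v : H} (hv : v ≠ 0) :
    DenseRange fun c => π c v := by
  let l : A →ₗ[ℂ] H :=
    { toFun := fun c => π c v
      map_add' := fun a b => by simp
      map_smul' := fun a b => by simp }
  have hinv : ∀ a, ∀ w ∈ l.range.topologicalClosure, π a w ∈ l.range.topologicalClosure := by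
    intro a w hw
    refine map_mem_closure (π a).continuous hw ?_
    rintro _ ⟨c, rfl⟩
    refine ⟨a * c, ?_⟩
    change π (a * c) v = π a (π c v)
    rw [map_mul]; rfl
  rcases hπ.2 _ l.range.isClosed_topologicalClosure hinv with h | h
  · exfalso
    have h0 : ∀ c, π c v = 0 := fun c => by
      have : l c ∈ l.range.topologicalClosure := l.range.le_topologicalClosure ⟨c, rfl⟩
      rw [h] at this
      exact this
    let N : Submodule ℂ H := ⨅ c, (π c).ker
    have hN : ∀ w, w ∈ N ↔ ∀ c, π c w = 0 := fun w => by simp [N]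
    have hNc : IsClosed (N : Set H) := by
      have : (N : Set H) = ⋂ c, (π c) ⁻¹' {0} := by
        ext w; simp [hN]
      rw [this]
      exact isClosed_iInter fun c => isClosed_singleton.preimage (π c).continuous
    rcases hπ.2 N hNc (fun a w hw => by
      rw [hN] at hw ⊢; intro c; rw [hw a, map_zero]) with h' | h'
    · have : v ∈ N := (hN v).2 h0
      rw [h'] at this
      exact hv this
    · obtain ⟨a, ha⟩ := hπ.1
      refine ha (ContinuousLinearMap.ext fun w => ?_)
      have : w ∈ N := by rw [h']; trivial
      exact (hN w).1 this a
  · intro w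
    have : w ∈ l.range.topologicalClosure := by rw [h]; trivial
    exact this

theorem eq_zero_or_eq_zero (hπ : IsIrreducibleRep π) {x y : A}
    (h : ∀ c, π (x * c * y) = 0) : π x = 0 ∨ π y = 0 := by
  by_contra! hxy
  obtain ⟨v, hv⟩ : ∃ v, π y v ≠ 0 := by
    by_contra! h0
    exact hxy.2 (ContinuousLinearMap.ext h0)
  refine hxy.1 (ContinuousLinearMap.ext fun w => ?_)
  refine congrFun ((hπ.denseRange hv).equalizer (π x).continuous
    (continuous_const (y := (0 : H))) (funext fun c => ?_)) w
  have := congrArg (fun T : H →L[ℂ] H => T v) (h c)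
  rw [map_mul, map_mul] at this
  exact this

theorem exists_mul_self_eq_smul (hπ : IsIrreducibleRep π) {z h : A} (hz : IsSelfAdjoint z)
    (hh : IsSelfAdjoint h) (hzh : ∀ y, ∃ y', h * y = z * y')
    (hq : ∀ x, (z * x * z) * (z * x * z) = 0 → π (z * x * z) = 0) :
    ∃ μ : ℝ, π h * π h = μ • π h := by
  have hp : IsSelfAdjoint (π h) := hh.map π
  by_cases hex : ∃ l ∈ quasispectrum ℝ (π h), ∃ m ∈ quasispectrum ℝ (π h), l ≠ 0 ∧ m ≠ 0 ∧ l ≠ m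
  · exfalso
    obtain ⟨l, hl, m, hm, hl0, hm0, hlm⟩ := hex
    obtain ⟨δ, hδ, hδl, hδm, hδlm⟩ : ∃ δ : ℝ, 0 < δ ∧ δ ≤ |l| ∧ δ ≤ |m| ∧ 2 * δ ≤ |l - m| := by
      have h1 : 0 < |l - m| := abs_pos.2 (sub_ne_zero.2 hlm)
      refine ⟨min (min |l| |m|) (|l - m| / 2), by positivity, ?_, ?_, ?_⟩
      · exact (min_le_left _ _).trans (min_le_left _ _)
      · exact (min_le_left _ _).trans (min_le_right _ _)
      · linarith [min_le_right (min |l| |m|) (|l - m| / 2)]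
    let b : ℝ → ℝ → ℝ := fun r t => max (δ - |t - r|) 0
    have hb : ∀ r, Continuous (b r) := fun r => by fun_prop
    have hb0 : ∀ r, δ ≤ |r| → b r 0 = 0 := fun r hr => by simp [b, hr]
    let F : ℝ → A := fun r => cfcₙ (fun t => t * b r t) h
    have hFl : ∀ r, δ ≤ |r| → F r = h * cfcₙ (b r) h := fun r hr => by
      change cfcₙ (fun t => t * b r t) h = _
      rw [cfcₙ_mul (fun t => t) (b r) h (by fun_prop) rfl (hb r).continuousOn (hb0 r hr),
        cfcₙ_id' ℝ h]
    have hFs : ∀ r, star (F r) = F r := fun r => (cfcₙ_predicate _ h : IsSelfAdjoint _)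
    have hF0 : ∀ r, r ∈ quasispectrum ℝ (π h) → r ≠ 0 → π (F r) ≠ 0 := fun r hr hr0 h0 => by
      have hc : Continuous fun t => t * b r t := continuous_id.mul (hb r)
      rw [π.map_cfcₙ _ h hc.continuousOn (by simp) π.continuous_of_cstar] at h0
      have h1 := cfcₙ_map_quasispectrum (fun t => t * b r t) (π h) hc.continuousOn (by simp)
      rw [h0, CFC.quasispectrum_zero_eq] at h1
      have h2 : r * b r r ∈ ({0} : Set ℝ) := by rw [h1]; exact ⟨r, hr, rfl⟩
      have h3 : b r r = δ := by simp [b, hδ.le]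
      rw [h3] at h2
      exact mul_ne_zero hr0 hδ.ne' h2
    have hml : F m * F l = 0 := by
      have hc : ∀ r, Continuous fun t => t * b r t := fun r => continuous_id.mul (hb r)
      rw [← cfcₙ_mul _ _ h (hc m).continuousOn (by simp) (hc l).continuousOn (by simp),
        ← cfcₙ_zero ℝ h]
      refine cfcₙ_congr fun t _ => ?_
      have : b m t * b l t = 0 := by
        rcases le_total (δ - |t - m|) 0 with h1 | h1
        · simp [b, h1]
        · rcases le_total (δ - |t - l|) 0 with h2 | h2
          · simp [b, h2]
          · have h3 : |l - m| ≤ |t - m| + |t - l| := by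
              have := abs_sub_le l t m
              rw [abs_sub_comm l t] at this; linarith
            have h4 : δ - |t - l| = 0 := by linarith
            simp [b, h4]
      change t * b m t * (t * b l t) = 0
      rw [mul_mul_mul_comm, this, mul_zero]
    obtain ⟨y₁, hy₁⟩ := hzh (cfcₙ (b l) h)
    obtain ⟨y₂, hy₂⟩ := hzh (cfcₙ (b m) h)
    have hl' : F l = z * y₁ := (hFl l hδl).trans hy₁
    have hm' : F m = star y₂ * z := by
      rw [← hFs, hFl m hδm, hy₂, star_mul, hz.star_eq]
    refine (hπ.eq_zero_or_eq_zero (x := F l) (y := F m) fun c => ?_).elim (hF0 l hl hl0)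
      (hF0 m hm hm0)
    have hqe : F l * c * F m = z * (y₁ * c * star y₂) * z := by
      rw [hl', hm']; noncomm_ring
    rw [hqe]
    refine hq _ ?_
    rw [← hqe, show F l * c * F m * (F l * c * F m) = F l * c * (F m * F l) * c * F m by
      noncomm_ring, hml]
    simp
  · push Not at hex
    obtain ⟨μ, hμ⟩ : ∃ μ, ∀ t ∈ quasispectrum ℝ (π h), t ≠ 0 → t = μ := by
      by_cases h1 : ∃ l ∈ quasispectrum ℝ (π h), l ≠ 0
      · obtain ⟨l, hl, hl0⟩ := h1
        exact ⟨l, fun t ht ht0 => (hex l hl t ht hl0 ht0).symm⟩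
      · push Not at h1
        exact ⟨0, fun t ht _ => h1 t ht⟩
    refine ⟨μ, ?_⟩
    conv_lhs => rw [← cfcₙ_id' ℝ (π h)]
    conv_rhs => rw [← cfcₙ_id' ℝ (π h)]
    rw [← cfcₙ_mul (fun t => t) (fun t => t) (π h) (by fun_prop) rfl (by fun_prop) rfl,
      ← cfcₙ_smul μ (fun t => t) (π h) (by fun_prop) rfl]
    refine cfcₙ_congr fun t ht => ?_
    by_cases ht0 : t = 0
    · simp [ht0]
    · simp [hμ t ht ht0]

variable {z : A}

theorem exists_ne_zero_mul_self_eq_smul (hπ : IsIrreducibleRep π) (hz : IsSelfAdjoint z)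
    (hz0 : π z ≠ 0) (hq : ∀ x, (z * x * z) * (z * x * z) = 0 → π (z * x * z) = 0) :
    ∃ l : ℝ, l ≠ 0 ∧ π z * π z = l • π z := by
  obtain ⟨l, hl⟩ := hπ.exists_mul_self_eq_smul hz hz (fun y => ⟨y, rfl⟩) hq
  refine ⟨l, fun h0 => hz0 ?_, hl⟩
  have hp : star (π z) = π z := hz.map π
  rw [h0, zero_smul] at hl
  rw [← CStarRing.star_mul_self_eq_zero_iff, hp, hl]

theorem exists_map_conj_eq_smul_of_isSelfAdjoint (hπ : IsIrreducibleRep π) (hz : IsSelfAdjoint z)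
    (hz0 : π z ≠ 0) (hq : ∀ x, (z * x * z) * (z * x * z) = 0 → π (z * x * z) = 0) {c : A}
    (hc : IsSelfAdjoint c) : ∃ r : ℝ, π (z * c * z) = r • π z := by
  obtain ⟨l, hl0, hl⟩ := hπ.exists_ne_zero_mul_self_eq_smul hz hz0 hq
  set P := π z with hP
  set X := π (z * c * z) with hX
  have hXP : X * P = l • X := by
    rw [hX, map_mul, mul_assoc, ← hP, hl, mul_smul_comm]
  have hPX : P * X = l • X := by
    rw [hX, mul_assoc, map_mul, ← mul_assoc, ← hP, hl, smul_mul_assoc]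
  have key : ∀ t : ℝ, ∃ μ : ℝ, (X + t • P) * (X + t • P) = μ • (X + t • P) := by
    intro t
    obtain ⟨μ, hμ⟩ := hπ.exists_mul_self_eq_smul (h := z * c * z + t • z) hz
      (by
        refine IsSelfAdjoint.add ?_ ((IsSelfAdjoint.all t).smul hz)
        have := hc.conjugate z
        rwa [hz.star_eq] at this)
      (fun y => ⟨c * z * y + t • y, by
        rw [add_mul, mul_add, smul_mul_assoc, mul_smul_comm]; simp only [mul_assoc]⟩) hq
    refine ⟨μ, ?_⟩
    rw [map_add, ← Complex.coe_smul, map_smul, Complex.coe_smul] at hμ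
    exact hμ
  have expand : ∀ t : ℝ, (X + t • P) * (X + t • P) = X * X + (2 * t * l) • X + (t ^ 2 * l) • P := by
    intro t
    rw [mul_add, add_mul, add_mul, smul_mul_assoc, smul_mul_smul_comm, mul_smul_comm, hXP, hPX, hl]
    module
  obtain ⟨μ₀, h0⟩ := key 0
  rw [zero_smul, add_zero] at h0
  obtain ⟨μ₁, h1⟩ := key 1
  obtain ⟨μ₂, h2⟩ := key 2
  rw [expand, h0] at h1 h2
  by_contra! hne
  have indep : ∀ α β : ℝ, α • X = β • P → α = 0 := by
    intro α β hαβ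
    by_contra hα
    refine hne (α⁻¹ * β) ?_
    rw [mul_smul, ← hαβ, smul_smul, inv_mul_cancel₀ hα, one_smul]
  have e1 : (μ₀ + 2 * l - μ₁) • X = (μ₁ - l) • P := by
    have : (μ₀ + 2 * l - μ₁) • X - (μ₁ - l) • P = 0 := by
      rw [← sub_eq_zero.2 h1]; module
    exact sub_eq_zero.1 this
  have e2 : (μ₀ + 4 * l - μ₂) • X = (2 * μ₂ - 4 * l) • P := by
    have : (μ₀ + 4 * l - μ₂) • X - (2 * μ₂ - 4 * l) • P = 0 := by
      rw [← sub_eq_zero.2 h2]; module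
    exact sub_eq_zero.1 this
  have f1 := indep _ _ e1
  have f2 := indep _ _ e2
  rw [f1, zero_smul] at e1
  rw [f2, zero_smul] at e2
  have g1 := (smul_eq_zero.1 e1.symm).resolve_right hz0
  have g2 := (smul_eq_zero.1 e2.symm).resolve_right hz0
  exact hl0 (by linarith)

theorem exists_map_conj_eq_smul (hπ : IsIrreducibleRep π) (hz : IsSelfAdjoint z)
    (hz0 : π z ≠ 0) (hq : ∀ x, (z * x * z) * (z * x * z) = 0 → π (z * x * z) = 0) (c : A) :
    ∃ r : ℂ, π (z * c * z) = r • π z := by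
  obtain ⟨r, hr⟩ := hπ.exists_map_conj_eq_smul_of_isSelfAdjoint hz hz0 hq (realPart c).2
  obtain ⟨s, hs⟩ := hπ.exists_map_conj_eq_smul_of_isSelfAdjoint hz hz0 hq (imaginaryPart c).2
  refine ⟨r + Complex.I * s, ?_⟩
  conv_lhs => rw [← realPart_add_I_smul_imaginaryPart c]
  rw [mul_add, add_mul, map_add, mul_smul_comm, smul_mul_assoc, map_smul, hr, hs, add_smul,
    mul_smul, Complex.coe_smul, Complex.coe_smul]

theorem exists_map_eq_smul_rankOne (hπ : IsIrreducibleRep π) (hz : IsSelfAdjoint z)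
    (hz0 : π z ≠ 0) (hq : ∀ x, (z * x * z) * (z * x * z) = 0 → π (z * x * z) = 0) :
    ∃ (η : H) (k : ℂ), η ≠ 0 ∧ k ≠ 0 ∧ π z = k • InnerProductSpace.rankOne ℂ η η := by
  have hP : star (π z) = π z := hz.map π
  obtain ⟨v, hv⟩ : ∃ v, π z v ≠ 0 := by
    by_contra! h0
    exact hz0 (ContinuousLinearMap.ext h0)
  set η := π z v with hη
  have hmem : ∀ w, π z w ∈ Submodule.span ℂ {η} := by
    intro w
    have hc : IsClosed {w | π z w ∈ Submodule.span ℂ {η}} :=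
      (Submodule.closed_of_finiteDimensional (Submodule.span ℂ {η})).preimage (π z).continuous
    refine (hπ.denseRange hv).induction_on w hc fun c => ?_
    obtain ⟨r, hr⟩ := hπ.exists_map_conj_eq_smul hz hz0 hq c
    have := congrArg (fun T : H →L[ℂ] H => T v) hr
    rw [map_mul, map_mul] at this
    exact Submodule.mem_span_singleton.2 ⟨r, this.symm⟩
  obtain ⟨k, hk⟩ := Submodule.mem_span_singleton.1 (hmem η)
  have hηη : (inner ℂ η η : ℂ) ≠ 0 := inner_self_ne_zero.2 hv
  have hform : π z = (star k / inner ℂ η η) • InnerProductSpace.rankOne ℂ η η := by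
    ext w
    obtain ⟨r, hr⟩ := Submodule.mem_span_singleton.1 (hmem w)
    have h1 : inner ℂ η (π z w) = inner ℂ (π z η) w := by
      conv_rhs => rw [← hP]
      rw [ContinuousLinearMap.star_eq_adjoint, ContinuousLinearMap.adjoint_inner_left]
    rw [← hr, ← hk, inner_smul_right, inner_smul_left] at h1
    rw [← hr, smul_apply, InnerProductSpace.rankOne_apply, smul_smul]
    congr 1
    field_simp
    exact h1
  refine ⟨η, _, hv, fun h0 => hz0 ?_, hform⟩
  rw [hform, h0, zero_smul]

theorem rankOne_mem_range (hπ : IsIrreducibleRep π) (hz : IsSelfAdjoint z)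
    (hz0 : π z ≠ 0) (hq : ∀ x, (z * x * z) * (z * x * z) = 0 → π (z * x * z) = 0) (x y : H) :
    InnerProductSpace.rankOne ℂ x y ∈ Set.range π := by
  obtain ⟨η, k, hη, hk, h⟩ := hπ.exists_map_eq_smul_rankOne hz hz0 hq
  have hcl := isClosed_range_of_cstar π
  have hx : ∀ c, InnerProductSpace.rankOne ℂ x (π c η) ∈ Set.range π := by
    intro c
    refine (hπ.denseRange hη).induction_on
      (p := fun x => InnerProductSpace.rankOne ℂ x (π c η) ∈ Set.range π) x
      (hcl.preimage (by fun_prop)) fun a => ⟨k⁻¹ • (a * z * star c), ?_⟩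
    rw [map_smul, map_mul, map_mul, h, map_star, mul_smul_comm, smul_mul_assoc, smul_smul,
      inv_mul_cancel₀ hk, one_smul, ContinuousLinearMap.mul_def, ContinuousLinearMap.mul_def,
      InnerProductSpace.comp_rankOne, InnerProductSpace.rankOne_comp,
      ContinuousLinearMap.star_eq_adjoint, ContinuousLinearMap.adjoint_adjoint]
  exact (hπ.denseRange hη).induction_on
    (p := fun y => InnerProductSpace.rankOne ℂ x y ∈ Set.range π) y
    (hcl.preimage (by fun_prop)) hx

end IsIrreducibleRep

theorem hasNonzeroElementaryIdealQuotient_of_irreducible {A : Type*} [NonUnitalCStarAlgebra A]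
    {H : Type} [NormedAddCommGroup H] [InnerProductSpace ℂ H] [CompleteSpace H]
    {π : A →⋆ₙₐ[ℂ] (H →L[ℂ] H)} (hπ : IsIrreducibleRep π) {z : A} (hz : IsSelfAdjoint z)
    (hz0 : π z ≠ 0) (hq : ∀ x, (z * x * z) * (z * x * z) = 0 → π (z * x * z) = 0) :
    HasNonzeroElementaryIdealQuotient A := by
  let J : ClosedTwoSidedIdealC A :=
    { carrier :=
        { carrier := {a | IsCompactOperator (π a)}
          add_mem' := fun {a b} ha hb => by
            change IsCompactOperator (π (a + b))
            rw [map_add]; exact IsCompactOperator.add ha hb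
          zero_mem' := by
            change IsCompactOperator (π 0)
            rw [map_zero]; exact isCompactOperator_zero
          mul_mem' := fun {a b} ha _ => by
            change IsCompactOperator (π (a * b))
            rw [map_mul]; exact ha.comp_clm (π b)
          smul_mem' := fun c a ha => by
            change IsCompactOperator (π (c • a))
            rw [map_smul]; exact ha.smul c
          star_mem' := fun {a} ha => by
            change IsCompactOperator (π (star a))
            rw [map_star]; exact ha.star }
      isClosed := isClosed_setOfPred_isCompactOperator.preimage π.continuous_of_cstar
      mul_mem_left := fun a x hx => by
        change IsCompactOperator (π (a * x))
        rw [map_mul]; exact hx.clm_comp (π a)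
      mul_mem_right := fun a x hx => by
        change IsCompactOperator (π (x * a))
        rw [map_mul]; exact hx.comp_clm (π a) }
  have hsurj : ∀ T : H →L[ℂ] H, IsCompactOperator T → ∃ a, π a = T := by
    intro T hT
    exact hT.mem_of_forall_rankOne_mem
      (N := AddMonoidHom.mrange (AddMonoidHomClass.toAddMonoidHom π : A →+ (H →L[ℂ] H)))
      (isClosed_range_of_cstar π)
      (hπ.rankOne_mem_range hz hz0 hq)
  refine ⟨J, H, inferInstance, inferInstance, inferInstance,
    π.comp (NonUnitalStarSubalgebraClass.subtype J.carrier), ?_, ?_⟩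
  · ext T
    constructor
    · rintro ⟨a, rfl⟩
      exact a.2
    · intro hT
      obtain ⟨a, rfl⟩ := hsurj T hT
      exact ⟨⟨a, hT⟩, rfl⟩
  · obtain ⟨η, k, -, -, h⟩ := hπ.exists_map_eq_smul_rankOne hz hz0 hq
    refine ⟨⟨z, ?_⟩, hz0⟩
    change IsCompactOperator (π z)
    rw [h]
    exact (isCompactOperator_rankOne η η).smul k

namespace IsCuntzSemigroupOf

theorem two_nsmul_cls_le_of_mul_self_eq_zero {A S : Type*} [NonUnitalCStarAlgebra A]
    [CuSemigroup S] (hS : IsCuntzSemigroupOf A S) {z x : hS.stab} (hz : IsSelfAdjoint z)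
    (hq : (z * x * z) * (z * x * z) = 0) :
    2 • hS.cls (star (z * x * z) * (z * x * z)) ≤ hS.cls (z * z) := by
  set q := z * x * z with hqdef
  have hz' : star z = z := hz
  have h0 : (star q * q) * (q * star q) = 0 := by
    rw [show (star q * q) * (q * star q) = star q * (q * q) * star q by noncomm_ring, hq,
      mul_zero, zero_mul]
  have hadd := hS.cls_add_of_mul_eq_zero (star_mul_self_nonneg q) (mul_star_self_nonneg q) h0
  rw [hS.cls_mul_star_self q, ← two_nsmul] at hadd
  rw [← hadd]
  set w := star x * (z * z) * x + x * (z * z) * star x with hw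
  have hwsa : IsSelfAdjoint w := by
    rw [IsSelfAdjoint, hw]
    simp [hz', mul_assoc]
  have e : star q * q + q * star q = star z * w * z := by
    rw [hqdef, hw]
    simp only [star_mul, hz']
    noncomm_ring
  have hle : star q * q + q * star q ≤ ‖w‖ • (z * z) := by
    rw [e]
    have := CStarAlgebra.star_left_conjugate_le_norm_smul (a := z) (b := w) hwsa
    rwa [hz'] at this ⊢
  refine hS.cls_le_of_le_smul (add_nonneg (star_mul_self_nonneg q) (mul_star_self_nonneg q)) ?_
    (norm_nonneg w) hle
  have := star_mul_self_nonneg z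
  rwa [hz'] at this

theorem isBelow_closure_of_nowhereScattered {A S : Type} [NonUnitalCStarAlgebra A]
    [CuSemigroup S] (hS : IsCuntzSemigroupOf A S) (hns : NowhereScattered A) (y : S) :
    CuSemigroup.IsBelow (AddSubmonoid.closure {w : S | 2 • w ≤ y}) y := by
  obtain ⟨b, hb, rfl⟩ := hS.exists_nonneg_cls_eq y
  set W := AddSubmonoid.closure {w : S | 2 • w ≤ hS.cls b} with hW
  by_contra hcon
  rw [← hS.mem_cuIdeal_of_nonneg hb] at hcon
  set L := hS.cuIdeal W
  have hsq : CFC.sqrt b ∉ L.carrier := fun h => hcon (by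
    rw [← CFC.sqrt_mul_sqrt_self b hb]
    exact L.mul_mem_left _ _ h)
  obtain ⟨u, s, hus⟩ : ∃ u s, hS.emb u * s * CFC.sqrt b ∉ L.carrier := by
    by_contra! h
    exact hsq (hS.mem_of_emb_mul_mem L h)
  set z0 := hS.emb u * s * CFC.sqrt b with hz0
  have hsa : star (CFC.sqrt b) = CFC.sqrt b := (CFC.sqrt_nonneg b).isSelfAdjoint
  have hz0z0 : z0 * star z0 = (hS.emb u * s) * b * star (hS.emb u * s) := by
    rw [hz0, star_mul, hsa]
    conv_rhs => rw [← CFC.sqrt_mul_sqrt_self b hb]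
    noncomm_ring
  obtain ⟨z, hz⟩ : ∃ z, hS.emb z = z0 * star z0 := by
    obtain ⟨z, hz⟩ := hS.emb_mul_mul_emb_mem_range u (star u) (s * b * star s)
    refine ⟨z, ?_⟩
    rw [hz, hz0z0, star_mul, map_star]
    noncomm_ring
  have hzL : hS.emb z ∉ L.carrier := fun h => by
    rw [hz] at h
    have h1 : star z0 ∈ L.carrier := L.mem_of_star_mul_self_mem (by rwa [star_star])
    have h2 := star_mem (s := L.carrier) h1
    rw [star_star] at h2
    exact hus h2
  have hz0' : 0 ≤ hS.emb z := by rw [hz]; exact mul_star_self_nonneg z0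
  have hzsa : IsSelfAdjoint z := hS.emb_injective (by
    rw [map_star]; exact hz0'.isSelfAdjoint)
  have hzsa' : IsSelfAdjoint (hS.emb z) := hz0'.isSelfAdjoint
  have hcls : hS.cls (hS.emb z * hS.emb z) ≤ hS.cls b := by
    have h1 : hS.cls (hS.emb z) ≤ hS.cls b := by
      rw [hz, hz0z0]; exact hS.cls_conj_le _ hb
    refine le_trans ?_ h1
    have hsa2 : star (CFC.sqrt (hS.emb z)) = CFC.sqrt (hS.emb z) :=
      (CFC.sqrt_nonneg _).isSelfAdjoint
    have h2 : hS.emb z * hS.emb z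
        = CFC.sqrt (hS.emb z) * hS.emb z * star (CFC.sqrt (hS.emb z)) := by
      rw [hsa2]
      conv_lhs => rw [← CFC.sqrt_mul_sqrt_self _ hz0']
      conv_rhs => enter [1, 2]; rw [← CFC.sqrt_mul_sqrt_self _ hz0']
      noncomm_ring
    rw [h2]
    exact hS.cls_conj_le _ hz0'
  obtain ⟨H, i1, i2, i3, π, hπ, hK, hπz⟩ := exists_irreducibleRep_of_notMem
    (L.comap hS.emb) (z := z) (fun h => hzL (ClosedTwoSidedIdealC.mem_comap.1 h))
  refine hns (hasNonzeroElementaryIdealQuotient_of_irreducible hπ hzsa hπz fun x hx => ?_)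
  refine hK _ (ClosedTwoSidedIdealC.mem_comap.2 ?_)
  rw [hS.mem_cuIdeal]
  refine CuSemigroup.isBelow_of_mem (AddSubmonoid.subset_closure ?_)
  rw [map_mul, map_mul]
  refine (hS.two_nsmul_cls_le_of_mul_self_eq_zero hzsa' ?_).trans hcls
  rw [← map_mul, ← map_mul, ← map_mul, hx, map_zero]

theorem isWeaklyOmegaDivisible_two {A S : Type} [NonUnitalCStarAlgebra A]
    [CuSemigroup S] (hS : IsCuntzSemigroupOf A S) (hns : NowhereScattered A) (y : S) :
    CuDiv.IsWeaklyOmegaDivisible 2 y := by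
  intro x' hx'
  obtain ⟨w, hw, hxw⟩ := hS.isBelow_closure_of_nowhereScattered hns y x' hx'
  obtain ⟨l, hl, rfl⟩ := AddSubmonoid.exists_list_of_mem_closure hw
  exact ⟨l.length, l.get, by simpa [← List.sum_ofFn] using hxw,
    fun j => hl _ (l.get_mem j)⟩

end IsCuntzSemigroupOf

/-- The kernel of a representation, as a closed two-sided ideal. -/
def ClosedTwoSidedIdealC.ker {A : Type*} [NonUnitalCStarAlgebra A] {H : Type*}
    [NormedAddCommGroup H] [InnerProductSpace ℂ H] [CompleteSpace H]
    (π : A →⋆ₙₐ[ℂ] (H →L[ℂ] H)) : ClosedTwoSidedIdealC A where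
  carrier :=
    { carrier := {a | π a = 0}
      add_mem' := fun {a b} (ha : π a = 0) (hb : π b = 0) => by
        change π (a + b) = 0
        rw [map_add, ha, hb, add_zero]
      zero_mem' := map_zero π
      mul_mem' := fun {a b} (ha : π a = 0) _ => by
        change π (a * b) = 0
        rw [map_mul, ha, zero_mul]
      smul_mem' := fun c a (ha : π a = 0) => by
        change π (c • a) = 0
        rw [map_smul, ha, smul_zero]
      star_mem' := fun {a} (ha : π a = 0) => by
        change π (star a) = 0
        rw [map_star, ha, star_zero] }
  isClosed := isClosed_singleton.preimage π.continuous_of_cstar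
  mul_mem_left := fun a x (hx : π x = 0) => by
    change π (a * x) = 0
    rw [map_mul, hx, mul_zero]
  mul_mem_right := fun a x (hx : π x = 0) => by
    change π (x * a) = 0
    rw [map_mul, hx, zero_mul]

namespace PrimIdealSpace

variable {A : Type*} [NonUnitalCStarAlgebra A]

theorem isOpen_setOf_notMem (a : A) : IsOpen {P : PrimIdealSpace A | a ∉ P.1.carrier} :=
  TopologicalSpace.isOpen_generateFrom_of_mem ⟨a, rfl⟩

theorem exists_notMem_of_isOpen {U : Set (PrimIdealSpace A)} (hU : IsOpen U) :
    ∀ P ∈ U, ∃ z : A, z ∉ P.1.carrier ∧ ∀ Q : PrimIdealSpace A, z ∉ Q.1.carrier → Q ∈ U := by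
  induction hU with
  | basic V hV =>
    obtain ⟨a, rfl⟩ := hV
    exact fun P hP => ⟨a, hP, fun Q hQ => hQ⟩
  | univ =>
    intro P _
    obtain ⟨H, _, _, _, π, hπ, hker⟩ := P.2
    obtain ⟨a, ha⟩ := hπ.1
    exact ⟨a, fun h => ha ((hker a).1 h), fun _ _ => trivial⟩
  | inter V W _ _ hV hW =>
    intro P hP
    obtain ⟨z, hz, hzV⟩ := hV P hP.1
    obtain ⟨w, hw, hwW⟩ := hW P hP.2
    obtain ⟨H, _, _, _, π, hπ, hker⟩ := P.2
    by_contra! hcon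
    have h0 : ∀ c, π (z * c * w) = 0 := by
      intro c
      by_contra hne
      obtain ⟨Q, hQ, hQ'⟩ := hcon (z * c * w) fun h => hne ((hker _).1 h)
      refine hQ' ⟨hzV Q fun h => hQ ?_, hwW Q fun h => hQ (Q.1.mul_mem_left _ _ h)⟩
      exact Q.1.mul_mem_right _ _ (Q.1.mul_mem_right _ _ h)
    rcases hπ.eq_zero_or_eq_zero h0 with h | h
    · exact hz ((hker z).2 h)
    · exact hw ((hker w).2 h)
  | sUnion 𝒱 _ ih =>
    rintro P ⟨V, hV, hP⟩
    obtain ⟨z, hz, hzV⟩ := ih V hV P hP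
    exact ⟨z, hz, fun Q hQ => ⟨V, hV, hzV Q hQ⟩⟩

end PrimIdealSpace

namespace IsCuntzSemigroupOf

section

variable {A S : Type*} [NonUnitalCStarAlgebra A] [CuSemigroup S] (hS : IsCuntzSemigroupOf A S)

theorem isClosed_image_emb (P : ClosedTwoSidedIdealC A) :
    IsClosed (hS.emb '' (P.carrier : Set A)) :=
  (NonUnitalStarAlgHom.isometry hS.emb hS.emb_injective).isClosedEmbedding.isClosedMap _ P.isClosed

/-- The closed ideal of the stabilization induced by a closed ideal of `A`. -/
def stabIdeal (P : ClosedTwoSidedIdealC A) : ClosedTwoSidedIdealC hS.stab where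
  carrier :=
    { carrier := {c | ∀ u s t v, hS.emb u * s * (c * t * hS.emb v) ∈ hS.emb '' P.carrier}
      add_mem' := fun {a b} ha hb u s t v => by
        obtain ⟨p, hp, hpe⟩ := ha u s t v
        obtain ⟨q, hq, hqe⟩ := hb u s t v
        refine ⟨p + q, add_mem hp hq, ?_⟩
        rw [map_add, hpe, hqe]
        noncomm_ring
      zero_mem' := fun u s t v => ⟨0, zero_mem _, by simp⟩
      mul_mem' := fun {a b} ha _ u s t v => by
        have := ha u s (b * t) v
        rwa [← mul_assoc a] at this
      smul_mem' := fun c a ha u s t v => by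
        obtain ⟨p, hp, hpe⟩ := ha u s t v
        refine ⟨c • p, P.carrier.smul_mem c hp, ?_⟩
        rw [map_smul, hpe, smul_mul_assoc, smul_mul_assoc, mul_smul_comm]
      star_mem' := fun {a} ha u s t v => by
        obtain ⟨p, hp, hpe⟩ := ha (star v) (star t) (star s) (star u)
        refine ⟨star p, star_mem hp, ?_⟩
        rw [map_star, hpe]
        simp [map_star, mul_assoc] }
  isClosed := by
    have : {c : hS.stab | ∀ u s t v, hS.emb u * s * (c * t * hS.emb v) ∈ hS.emb '' P.carrier} =
        ⋂ (u) (s) (t) (v), (fun c => hS.emb u * s * (c * t * hS.emb v)) ⁻¹'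
          (hS.emb '' (P.carrier : Set A)) := by
      ext c; simp
    change IsClosed {c : hS.stab | ∀ u s t v,
      hS.emb u * s * (c * t * hS.emb v) ∈ hS.emb '' P.carrier}
    rw [this]
    exact isClosed_iInter fun u => isClosed_iInter fun s => isClosed_iInter fun t =>
      isClosed_iInter fun v => (hS.isClosed_image_emb P).preimage (by fun_prop)
  mul_mem_left := fun a x hx u s t v => by
    have := hx u (s * a) t v
    rwa [show hS.emb u * (s * a) * (x * t * hS.emb v) = hS.emb u * s * (a * x * t * hS.emb v) by
      noncomm_ring] at this
  mul_mem_right := fun a x hx u s t v => by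
    have := hx u s (a * t) v
    rwa [← mul_assoc x] at this

variable {hS}

theorem mem_stabIdeal {P : ClosedTwoSidedIdealC A} {c : hS.stab} :
    c ∈ (hS.stabIdeal P).carrier ↔
      ∀ u s t v, hS.emb u * s * (c * t * hS.emb v) ∈ hS.emb '' P.carrier := Iff.rfl

theorem emb_mem_stabIdeal {P : ClosedTwoSidedIdealC A} {z : A} :
    hS.emb z ∈ (hS.stabIdeal P).carrier ↔ z ∈ P.carrier := by
  have hsa : star (star z * z) = star z * z := by simp
  constructor
  · intro h
    obtain ⟨p, hp, hpe⟩ := h z (hS.emb (star z)) (hS.emb (star z)) z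
    simp only [← map_mul] at hpe
    rw [hS.emb_injective hpe] at hp
    refine P.mem_of_star_mul_self_mem (P.mem_of_star_mul_self_mem
      (P.mem_of_star_mul_self_mem ?_))
    have := P.mul_mem_left (star z * z * star z) _ hp
    simpa [mul_assoc] using this
  · intro h
    refine (hS.stabIdeal P).mem_of_star_mul_self_mem
      ((hS.stabIdeal P).mem_of_star_mul_self_mem ?_)
    intro u s t v
    obtain ⟨u', hu'⟩ := hS.emb_mul_mul_emb_mem_range u (star z) s
    obtain ⟨v', hv'⟩ := hS.emb_mul_mul_emb_mem_range z v t
    refine ⟨u' * (z * star z) * v',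
      P.mul_mem_right _ _ (P.mul_mem_left _ _ (P.mul_mem_right _ _ h)), ?_⟩
    rw [map_mul, map_mul, map_mul, hu', hv', map_star]
    simp [mul_assoc]

theorem mem_stabIdeal_of_cls_le {P : ClosedTwoSidedIdealC A} {a b : hS.stab} (ha : 0 ≤ a)
    (hb : 0 ≤ b) (h : hS.cls a ≤ hS.cls b) (hbP : b ∈ (hS.stabIdeal P).carrier) :
    a ∈ (hS.stabIdeal P).carrier := by
  obtain ⟨r, hr⟩ := (hS.cls_le_cls_iff ha hb).1 h
  exact (hS.stabIdeal P).isClosed.mem_of_tendsto hr (Eventually.of_forall fun n =>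
    (hS.stabIdeal P).mul_mem_right _ _ ((hS.stabIdeal P).mul_mem_left _ _ hbP))

variable (hS) in
/-- The set of primitive ideals not containing a given element of the Cuntz semigroup. -/
def supp (x : S) : Set (PrimIdealSpace A) :=
  {P | ∃ a, 0 ≤ a ∧ hS.cls a = x ∧ a ∉ (hS.stabIdeal P.1).carrier}

theorem mem_supp_cls {a : hS.stab} (ha : 0 ≤ a) {P : PrimIdealSpace A} :
    P ∈ hS.supp (hS.cls a) ↔ a ∉ (hS.stabIdeal P.1).carrier := by
  constructor
  · rintro ⟨b, hb, hab, hbP⟩ h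
    exact hbP (mem_stabIdeal_of_cls_le hb ha hab.le h)
  · exact fun h => ⟨a, ha, rfl, h⟩

theorem supp_mono {x y : S} (h : x ≤ y) : hS.supp x ⊆ hS.supp y := by
  obtain ⟨a, ha, rfl⟩ := hS.exists_nonneg_cls_eq x
  obtain ⟨b, hb, rfl⟩ := hS.exists_nonneg_cls_eq y
  intro P hP
  rw [mem_supp_cls ha] at hP
  rw [mem_supp_cls hb]
  exact fun hbP => hP (mem_stabIdeal_of_cls_le ha hb h hbP)

theorem supp_zero : hS.supp 0 = ∅ := by
  ext P
  rw [← hS.cls_zero, mem_supp_cls le_rfl]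
  simp [zero_mem]

theorem supp_add (x y : S) : hS.supp (x + y) = hS.supp x ∪ hS.supp y := by
  refine subset_antisymm ?_ (Set.union_subset (supp_mono (CuSemigroup.le_add_right _ _))
    (supp_mono (CuSemigroup.le_add_left _ _)))
  obtain ⟨a, b, ha, hb, hab, rfl, rfl⟩ := hS.exists_orthogonal x y
  rw [← hS.cls_add_of_mul_eq_zero ha hb hab]
  intro P hP
  rw [mem_supp_cls (add_nonneg ha hb)] at hP
  by_contra! hcon
  simp only [Set.mem_union, mem_supp_cls ha, mem_supp_cls hb, not_or, not_not] at hcon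
  exact hP (add_mem hcon.1 hcon.2)

theorem exists_wayBelow_mem_supp {x : S} {P : PrimIdealSpace A} (h : P ∈ hS.supp x) :
    ∃ x', WayBelow x' x ∧ P ∈ hS.supp x' := by
  obtain ⟨a, ha, rfl⟩ := hS.exists_nonneg_cls_eq x
  rw [mem_supp_cls ha] at h
  by_contra! hcon
  refine h ((hS.stabIdeal P.1).isClosed.closure_subset (Metric.mem_closure_iff.2 fun ε hε => ?_))
  have h1 := hcon _ (hS.cls_cutDown_wayBelow ha (half_pos hε))
  rw [mem_supp_cls (cutDown_nonneg a (ε / 2)), not_not] at h1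
  refine ⟨_, h1, ?_⟩
  rw [dist_eq_norm]
  exact (norm_sub_cutDown_le ha (half_pos hε).le).trans_lt (half_lt_self hε)

theorem exists_mem_supp_of_isLUB {f : ℕ → S} (hf : Monotone f) {x : S}
    (hx : IsLUB (Set.range f) x) {P : PrimIdealSpace A} (h : P ∈ hS.supp x) :
    ∃ n, P ∈ hS.supp (f n) := by
  obtain ⟨x', hx', hP⟩ := exists_wayBelow_mem_supp h
  obtain ⟨n, hn⟩ := hx' f hf x hx le_rfl
  exact ⟨n, supp_mono hn hP⟩

theorem supp_nsmul_subset (n : ℕ) (x : S) : hS.supp (n • x) ⊆ hS.supp x := by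
  induction n with
  | zero => rw [zero_smul, supp_zero]; exact Set.empty_subset _
  | succ n ih => rw [succ_nsmul, supp_add]; exact Set.union_subset ih le_rfl

theorem supp_infty_subset (x : S) : hS.supp (CuSemigroup.infty x) ⊆ hS.supp x := by
  intro P hP
  obtain ⟨n, hn⟩ := exists_mem_supp_of_isLUB (CuSemigroup.nsmul_mono x)
    (CuSemigroup.isLUB_infty x) hP
  exact supp_nsmul_subset n x hn

theorem exists_emb_eq_of_mem_supp {a : hS.stab} (ha : 0 ≤ a) {P : PrimIdealSpace A}
    (h : P ∈ hS.supp (hS.cls a)) :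
    ∃ z, z ∉ P.1.carrier ∧ ∃ u s t v, hS.emb z = hS.emb u * s * (a * t * hS.emb v) := by
  rw [mem_supp_cls ha, mem_stabIdeal] at h
  push Not at h
  obtain ⟨u, s, t, v, h⟩ := h
  obtain ⟨z, hz⟩ := hS.emb_mul_mul_emb_mem_range u v (s * a * t)
  have hz' : hS.emb z = hS.emb u * s * (a * t * hS.emb v) := by rw [hz]; noncomm_ring
  exact ⟨z, fun hzP => h ⟨z, hzP, hz'⟩, u, s, t, v, hz'⟩

theorem isOpen_supp (x : S) : IsOpen (hS.supp x) := by
  obtain ⟨a, ha, rfl⟩ := hS.exists_nonneg_cls_eq x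
  rw [isOpen_iff_forall_mem_open]
  intro P hP
  obtain ⟨z, hzP, u, s, t, v, hz⟩ := exists_emb_eq_of_mem_supp ha hP
  refine ⟨_, fun Q hQ => ?_, PrimIdealSpace.isOpen_setOf_notMem z, hzP⟩
  rw [mem_supp_cls ha]
  refine fun haQ => hQ ((emb_mem_stabIdeal (hS := hS)).1 ?_)
  rw [hz]
  exact (hS.stabIdeal Q.1).mul_mem_left _ _ ((hS.stabIdeal Q.1).mul_mem_right _ _
    ((hS.stabIdeal Q.1).mul_mem_right _ _ haQ))

theorem mem_supp_emb {z : A} {P : PrimIdealSpace A} :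
    P ∈ hS.supp (hS.cls (star (hS.emb z) * hS.emb z)) ↔ z ∉ P.1.carrier := by
  rw [mem_supp_cls (star_mul_self_nonneg _), not_iff_not]
  refine ⟨fun h => emb_mem_stabIdeal.1 ((hS.stabIdeal P.1).mem_of_star_mul_self_mem h),
    fun h => (hS.stabIdeal P.1).mul_mem_left _ _ (emb_mem_stabIdeal.2 h)⟩

theorem exists_supp_eq_of_isCompact {U : Set (PrimIdealSpace A)} (hU : IsOpen U)
    (hc : IsCompact U) : ∃ w, hS.supp w = U := by
  let Z : Type _ := {z : A // ∀ Q : PrimIdealSpace A, z ∉ Q.1.carrier → Q ∈ U}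
  obtain ⟨t, ht⟩ := hc.elim_finite_subcover
    (fun z : Z => {P : PrimIdealSpace A | z.1 ∉ P.1.carrier})
    (fun z => PrimIdealSpace.isOpen_setOf_notMem z.1) (fun P hP => by
      obtain ⟨z, hz, hzU⟩ := PrimIdealSpace.exists_notMem_of_isOpen hU P hP
      exact Set.mem_iUnion.2 ⟨⟨z, hzU⟩, hz⟩)
  have key : ∀ t : Finset Z, ∃ w, hS.supp w =
      ⋃ z ∈ t, {P : PrimIdealSpace A | z.1 ∉ P.1.carrier} := by
    classical
    intro t
    induction t using Finset.induction_on with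
    | empty => exact ⟨0, by simp [supp_zero]⟩
    | insert z t _ ih =>
      obtain ⟨w, hw⟩ := ih
      refine ⟨hS.cls (star (hS.emb z.1) * hS.emb z.1) + w, ?_⟩
      rw [supp_add, hw, Finset.set_biUnion_insert]
      congr 1
      ext P
      exact mem_supp_emb
  obtain ⟨w, hw⟩ := key t
  refine ⟨w, hw.trans (subset_antisymm ?_ ht)⟩
  exact Set.iUnion₂_subset fun z _ => z.2

theorem exists_le_mem_supp_of_le_nsmul {x : S} {P : PrimIdealSpace A} (n : ℕ) :
    ∀ w, P ∈ hS.supp w → w ≤ n • x → ∃ v, v ≤ w ∧ v ≤ x ∧ P ∈ hS.supp v := by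
  induction n with
  | zero =>
    intro w hP hw
    have := supp_mono hw hP
    rw [zero_smul, supp_zero] at this
    exact this.elim
  | succ n ih =>
    intro w hP hw
    obtain ⟨w', hw', hP'⟩ := exists_wayBelow_mem_supp hP
    rw [succ_nsmul] at hw
    obtain ⟨v₁, v₂, h1, h2, h3, h4, h5⟩ := CuSemigroup.almost_riesz w' w _ _ hw' hw
    have := supp_mono h5 hP'
    rw [supp_add] at this
    rcases this with h | h
    · obtain ⟨v, hv1, hv2, hvP⟩ := ih v₁ h h2
      exact ⟨v, hv1.trans h1, hv2, hvP⟩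
    · exact ⟨v₂, h3, h4, h⟩

end

variable {A S : Type} [NonUnitalCStarAlgebra A] [CuSemigroup S] {hS : IsCuntzSemigroupOf A S}

theorem isBelow_of_supp {W : AddSubmonoid S} {x : S}
    (h : ∀ P ∈ hS.supp x, ∃ w ∈ W, P ∈ hS.supp w) : CuSemigroup.IsBelow W x := by
  obtain ⟨a, ha, rfl⟩ := hS.exists_nonneg_cls_eq x
  by_contra hcon
  rw [← hS.mem_cuIdeal_of_nonneg ha] at hcon
  obtain ⟨u, s, t, v, hust⟩ : ∃ u s t v,
      hS.emb u * s * (a * t * hS.emb v) ∉ (hS.cuIdeal W).carrier := by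
    by_contra! h
    exact hcon (hS.mem_of_emb_mul_mul_emb_mem _ h)
  obtain ⟨z, hz⟩ := hS.emb_mul_mul_emb_mem_range u v (s * a * t)
  have hz' : hS.emb z = hS.emb u * s * (a * t * hS.emb v) := by rw [hz]; noncomm_ring
  rw [← hz'] at hust
  obtain ⟨H, i1, i2, i3, π, hπ, hK, hπz⟩ := exists_irreducibleRep_of_notMem
    ((hS.cuIdeal W).comap hS.emb) (z := z)
    (fun h => hust (ClosedTwoSidedIdealC.mem_comap.1 h))
  let P : PrimIdealSpace A :=
    ⟨ClosedTwoSidedIdealC.ker π, H, i1, i2, i3, π, hπ, fun _ => Iff.rfl⟩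
  obtain ⟨w, hw, hPw⟩ := h P ((mem_supp_cls ha).2 fun haP => hπz (by
    refine (emb_mem_stabIdeal (hS := hS) (P := P.1)).1 ?_
    rw [hz']
    exact (hS.stabIdeal P.1).mul_mem_left _ _ ((hS.stabIdeal P.1).mul_mem_right _ _
      ((hS.stabIdeal P.1).mul_mem_right _ _ haP))))
  obtain ⟨b, hb, rfl⟩ := hS.exists_nonneg_cls_eq w
  obtain ⟨z', hz'P, u', s', t', v', hz''⟩ := exists_emb_eq_of_mem_supp hb hPw
  refine hz'P (hK z' (ClosedTwoSidedIdealC.mem_comap.2 ?_))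
  have hbL : b ∈ (hS.cuIdeal W).carrier :=
    (hS.mem_cuIdeal_of_nonneg hb).2 (CuSemigroup.isBelow_of_mem hw)
  rw [hz'']
  exact (hS.cuIdeal W).mul_mem_left _ _ ((hS.cuIdeal W).mul_mem_right _ _
      ((hS.cuIdeal W).mul_mem_right _ _ hbL))

theorem exists_le_nsmul_of_supp_subset {x y z : S} (h : hS.supp y ⊆ hS.supp z)
    (hx : WayBelow x y) : ∃ n : ℕ, x ≤ n • z := by
  obtain ⟨w, hw, hxw⟩ := isBelow_of_supp (hS := hS) (W := AddSubmonoid.multiples z) (x := y)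
    (fun P hP => ⟨z, AddSubmonoid.mem_multiples z, h hP⟩) x hx
  obtain ⟨n, rfl⟩ := (AddSubmonoid.mem_multiples_iff _ _).1 hw
  exact ⟨n, hxw⟩

theorem supp_meetInfty {x w : S} (h : hS.supp w ⊆ hS.supp x) :
    hS.supp (CuSemigroup.meetInfty x w) = hS.supp w := by
  have hglb := CuSemigroup.isGLB_meetInfty x w
  refine subset_antisymm ((supp_mono (hglb.1 (by simp))).trans (supp_infty_subset w)) ?_
  intro P hP
  obtain ⟨w', hw', hP'⟩ := exists_wayBelow_mem_supp hP
  obtain ⟨n, hn⟩ := exists_le_nsmul_of_supp_subset h hw'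
  obtain ⟨v, hvw, hvx, hvP⟩ := exists_le_mem_supp_of_le_nsmul n w' hP' hn
  refine supp_mono (hglb.2 ?_) hvP
  rintro _ (rfl | rfl)
  · exact hvx
  · refine (hvw.trans hw'.le).trans ((CuSemigroup.isLUB_infty w).1 ⟨1, one_smul _ _⟩)

theorem exists_supp_subset_of_isLUB {f : ℕ → S} (hf : Monotone f) {x : S}
    (hx : IsLUB (Set.range f) x) {K : Set (PrimIdealSpace A)} (hK : IsCompact K)
    (hKx : K ⊆ hS.supp x) : ∃ n, K ⊆ hS.supp (f n) :=
  hK.elim_directed_cover (fun n => hS.supp (f n)) (fun _ => isOpen_supp _)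
    (fun _ hP => Set.mem_iUnion.2 (exists_mem_supp_of_isLUB hf hx (hKx hP)))
    (directed_of_isDirected_le fun _ _ hij => supp_mono (hf hij))

theorem exists_isCompact_supp_le (htd0 : TopDimZero A) {x x' : S} (h : WayBelow x' x) :
    ∃ w, IsCompact (hS.supp w) ∧ hS.supp w ⊆ hS.supp x ∧ x' ≤ w := by
  let W : AddSubmonoid S :=
    { carrier := {w | IsCompact (hS.supp w) ∧ hS.supp w ⊆ hS.supp x}
      zero_mem' := by
        change IsCompact (hS.supp 0) ∧ hS.supp 0 ⊆ hS.supp x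
        rw [supp_zero]
        exact ⟨isCompact_empty, Set.empty_subset _⟩
      add_mem' := fun {a b} ha hb => by
        change IsCompact (hS.supp (a + b)) ∧ hS.supp (a + b) ⊆ hS.supp x
        rw [supp_add]
        exact ⟨ha.1.union hb.1, Set.union_subset ha.2 hb.2⟩ }
  obtain ⟨𝒷, hb, hbc⟩ := htd0
  obtain ⟨w, hw, hxw⟩ := isBelow_of_supp (hS := hS) (W := W) (x := x) (fun P hP => by
    obtain ⟨U, hU, hPU, hUx⟩ := hb.exists_subset_of_mem_open hP (isOpen_supp x)
    obtain ⟨w, rfl⟩ := exists_supp_eq_of_isCompact (hS := hS) (hbc U hU).2 (hbc U hU).1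
    exact ⟨w, ⟨(hbc _ hU).1, hUx⟩, hPU⟩) x' h
  exact ⟨w, hw.1, hw.2, hxw⟩

theorem wdiv_two_lt_top (hS : IsCuntzSemigroupOf A S) (hns : NowhereScattered A) {y y' : S}
    (h : WayBelow y' y) {N : ℕ} (hN : y ≤ N • y') : CuDiv.wdiv 2 y < ⊤ := by
  obtain ⟨n, v, hv, hvy⟩ := hS.isWeaklyOmegaDivisible_two hns y y' h
  have hdiv : CuDiv.IsWeaklyDivisible 2 (N * n + 1) y := by
    intro x' hx'
    let e : Fin (N * n + 1) ≃ Option (Fin N × Fin n) :=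
      Fintype.equivFinOfCardEq (by simp) |>.symm
    refine ⟨fun j => (e j).elim 0 fun p => v p.2, ?_, fun j => ?_⟩
    · rw [e.sum_comp (fun o => o.elim 0 fun p => v p.2), Fintype.sum_option,
        Fintype.sum_prod_type]
      simp only [Option.elim_none, Option.elim_some, zero_add, Finset.sum_const,
        Finset.card_univ, Fintype.card_fin]
      exact hx'.le.trans (hN.trans (CuSemigroup.nsmul_le_nsmul N hv))
    · change 2 • (e j).elim 0 (fun p => v p.2) ≤ y
      rcases e j with _ | p
      · rw [Option.elim_none, smul_zero]
        exact CuSemigroup.zero_le' y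
      · exact hvy p.2
  refine lt_of_le_of_lt (sInf_le ⟨N * n + 1, by omega, rfl, hdiv⟩) (ENat.natCast_lt_top _)

theorem exists_wdiv_lt_top_between (hS : IsCuntzSemigroupOf A S) (hns : NowhereScattered A)
    (htd0 : TopDimZero A) {x x' : S} (h : WayBelow x' x) :
    ∃ y, x' ≤ y ∧ WayBelow y x ∧ CuDiv.wdiv 2 y < ⊤ := by
  obtain ⟨x'', h', h''⟩ := CuSemigroup.exists_wayBelow_between h
  obtain ⟨w, hwc, hwx, hxw⟩ := exists_isCompact_supp_le (hS := hS) htd0 h''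
  obtain ⟨f, hf, hfw, hfx⟩ := CuSemigroup.exists_waybelow_seq x
  obtain ⟨i, hi⟩ := exists_supp_subset_of_isLUB hf hfx hwc hwx
  obtain ⟨j, hj⟩ := h'' f hf x hfx le_rfl
  set k := max i j
  have hk : WayBelow (f k) x := (hfw k).trans_le (hfx.1 ⟨k + 1, rfl⟩)
  have hglb := CuSemigroup.isGLB_meetInfty (f k) w
  have hsupp := supp_meetInfty (hS := hS) (hi.trans (supp_mono (hf (le_max_left i j))))
  set v := CuSemigroup.meetInfty (f k) w
  have hv : v ≤ f k := hglb.1 (by simp)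
  have hxv : x'' ≤ v := hglb.2 (by
    rintro _ (rfl | rfl)
    · exact hj.trans (hf (le_max_right i j))
    · exact hxw.trans ((CuSemigroup.isLUB_infty w).1 ⟨1, one_smul _ _⟩))
  obtain ⟨g, hg, hgw, hgv⟩ := CuSemigroup.exists_waybelow_seq v
  obtain ⟨p, hp⟩ := exists_supp_subset_of_isLUB hg hgv (hsupp ▸ hwc) le_rfl
  obtain ⟨q, hq⟩ := (h'.trans_le hxv) g hg v hgv le_rfl
  set r := max p q
  have hr1 : WayBelow (g (r + 1)) v := (hgw (r + 1)).trans_le (hgv.1 ⟨r + 2, rfl⟩)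
  obtain ⟨N, hN⟩ := exists_le_nsmul_of_supp_subset
    (hp.trans (supp_mono (hg (le_max_left p q)))) hr1
  exact ⟨g (r + 1), hq.trans (hg ((le_max_right p q).trans (Nat.le_succ r))),
    CuSemigroup.wayBelow_of_le (hr1.le.trans hv) hk, hS.wdiv_two_lt_top hns (hgw r) hN⟩

end IsCuntzSemigroupOf

/-- Lemma 3.9.  For a separable, nowhere scattered C*-algebra of
topological dimension zero, the set of elements of `Cu(A)` with finite weak divisibility
is sup-dense in `Cu(A)`. -/
theorem wdiv_supDense_of_topDimZero
    (A : Type) [NonUnitalCStarAlgebra A] (S : Type) [CuSemigroup S]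
    (hS : IsCuntzSemigroupOf A S)
    (hsep : TopologicalSpace.SeparableSpace A)
    (hns : NowhereScattered A)
    (htd0 : TopDimZero A) :
    ∀ x : S, ∃ f : ℕ → S, Monotone f ∧
      (∀ k, ∃ m : ℕ, 1 ≤ m ∧ CuDiv.wdiv (2 * m) (f k) < ⊤) ∧ IsLUB (Set.range f) x := by
  intro x
  obtain ⟨f, hf, hfw, hfx⟩ := CuSemigroup.exists_waybelow_seq x
  have hfx' : ∀ k, WayBelow (f k) x := fun k => (hfw k).trans_le (hfx.1 ⟨k + 1, rfl⟩)
  let Y : Type := {y : S // WayBelow y x ∧ CuDiv.wdiv 2 y < ⊤}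
  have hbase : ∀ k, ∃ y : Y, f k ≤ y.1 := fun k => by
    obtain ⟨y, h1, h2, h3⟩ := hS.exists_wdiv_lt_top_between hns htd0 (hfx' k)
    exact ⟨⟨y, h2, h3⟩, h1⟩
  have hstep : ∀ (k : ℕ) (y : Y), ∃ y' : Y, f k ≤ y'.1 ∧ y.1 ≤ y'.1 := fun k y => by
    obtain ⟨j, hj⟩ := y.2.1 f hf x hfx le_rfl
    obtain ⟨y', hy'⟩ := hbase (max j k)
    exact ⟨y', (hf (le_max_right j k)).trans hy', hj.trans ((hf (le_max_left j k)).trans hy')⟩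
  obtain ⟨y₀, hy₀⟩ := hbase 0
  choose next hnext using hstep
  let g : ℕ → Y := fun n => Nat.rec y₀ (fun k y => next (k + 1) y) n
  have hg : ∀ k, f k ≤ (g k).1 := by
    intro k
    cases k with
    | zero => exact hy₀
    | succ k => exact (hnext (k + 1) (g k)).1
  refine ⟨fun k => (g k).1, monotone_nat_of_le_succ fun k => (hnext (k + 1) (g k)).2,
    fun k => ⟨1, le_rfl, (g k).2.2⟩, ?_, fun u hu => hfx.2 ?_⟩
  · rintro _ ⟨k, rfl⟩
    exact (g k).2.1.le
  · rintro _ ⟨k, rfl⟩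
    exact (hg k).trans (hu ⟨k, rfl⟩)
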